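/- Let (A_S,S) be an Artin-Tits system of spherical type and X ⊆ S. Then {g ∈ A_S : there exists k ∈ ℕ, k ≥ 1, with gΔ_X^k g⁻¹ ∈ A_X} ⊆ A_X · QZ_{A_S}(A_X), and moreover A_X · QZ_{A_S}(A_X) = QZ_{A_S}(A_X) · A_X. -/

import Mathlib

/-!
Common definitions for formalizing "Normalisateur des sous-groupes paraboliques
des groupes d'Artin-Tits" (E. Godelle).

We fix a Coxeter matrix `M` over a finite index set `B` (Mathlib's convention:
`M s t = 0` encodes `m_{s,t} = ∞`).  The Artin-Tits group `Artin M` is the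
presented group on the braid relations, the Coxeter group is Mathlib's
`M.Group`, and `proj : Artin M →* M.Group` is the canonical projection
(adding the relations `s² = 1`).
-/

namespace ArtinTitsPaper

open List

variable {B : Type*}

/-- The alternating list `[s, t, s, t, ...]` with `n` terms, starting with `s`. -/
def altList (s t : B) : ℕ → List B
  | 0 => []
  | n + 1 => s :: altList t s n

/-- The braid relators `(sts⋯)(tst⋯)⁻¹` (`m_{s,t}` letters each) for `s ≠ t`,
`m_{s,t} ≠ ∞`. -/
def braidRels (M : CoxeterMatrix B) : Set (FreeGroup B) :=
  { r | ∃ s t : B, s ≠ t ∧ M s t ≠ 0 ∧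
      r = ((altList s t (M s t)).map FreeGroup.of).prod *
          (((altList t s (M s t)).map FreeGroup.of).prod)⁻¹ }

/-- The Artin-Tits group associated to the Coxeter matrix `M`. -/
def Artin (M : CoxeterMatrix B) : Type _ := PresentedGroup (braidRels M)

instance (M : CoxeterMatrix B) : Group (Artin M) :=
  QuotientGroup.Quotient.group _

/-- The standard generator of `Artin M` indexed by `s : B` (the image of `S` in `A_S`). -/
def gen (M : CoxeterMatrix B) (s : B) : Artin M := PresentedGroup.of s

theorem altList_eq_reverse_alternatingWord (s t : B) (n : ℕ) :
    altList s t n = (CoxeterSystem.alternatingWord t s n).reverse := by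
  induction n generalizing s t with
  | zero => rfl
  | succ n ih =>
      rw [altList, CoxeterSystem.alternatingWord_succ, List.concat_eq_append,
        List.reverse_append]
      simp [ih]

theorem lift_simple_listProd (M : CoxeterMatrix B) (l : List B) :
    FreeGroup.lift M.simple ((l.map FreeGroup.of).prod) =
      M.toCoxeterSystem.wordProd l := by
  rw [CoxeterSystem.wordProd, map_list_prod, List.map_map]
  simp [Function.comp_def, CoxeterMatrix.toCoxeterSystem_simple]

theorem braid_lift (M : CoxeterMatrix B) :
    ∀ r ∈ braidRels M, FreeGroup.lift M.simple r = 1 := by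
  rintro r ⟨s, t, hst, hm, rfl⟩
  rw [map_mul, map_inv, lift_simple_listProd, lift_simple_listProd,
    altList_eq_reverse_alternatingWord, altList_eq_reverse_alternatingWord,
    CoxeterSystem.wordProd_reverse, CoxeterSystem.wordProd_reverse]
  have hsym : M s t = M t s := M.symmetric s t
  have hb := M.toCoxeterSystem.wordProd_braidWord_eq t s
  rw [CoxeterSystem.braidWord, CoxeterSystem.braidWord, ← hsym] at hb
  rw [hb]
  simp

/-- The canonical projection from the Artin-Tits group onto the Coxeter group
(adding the relations `s² = 1`). -/
def proj (M : CoxeterMatrix B) : Artin M →* M.Group :=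
  PresentedGroup.toGroup (braid_lift M)

/-- The positive monoid `A_S⁺`, the submonoid of `A_S` generated by `S`. -/
def posMon (M : CoxeterMatrix B) : Submonoid (Artin M) :=
  Submonoid.closure (Set.range (gen M))

/-- The submonoid `A_X⁺` of `A_S` generated by `X ⊆ S`. -/
def posMonOn (M : CoxeterMatrix B) (X : Set B) : Submonoid (Artin M) :=
  Submonoid.closure (gen M '' X)

/-- The standard parabolic subgroup `A_X` of `A_S` generated by `X ⊆ S`. -/
def stdSub (M : CoxeterMatrix B) (X : Set B) : Subgroup (Artin M) :=
  Subgroup.closure (gen M '' X)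

/-- The standard parabolic subgroup `W_X` of the Coxeter group `W_S`. -/
def coxSub (M : CoxeterMatrix B) (X : Set B) : Subgroup M.Group :=
  Subgroup.closure (M.simple '' X)

/-- `X ⊆ S` is of spherical type if the Coxeter group `W_X` is finite. -/
def IsSpherical (M : CoxeterMatrix B) (X : Set B) : Prop :=
  Finite (coxSub M X)

/-- `a` left-divides `b` in the positive monoid: `b = a c` with `c ∈ A_S⁺`. -/
def ldvd (M : CoxeterMatrix B) (a b : Artin M) : Prop :=
  ∃ c ∈ posMon M, a * c = b

/-- `a` right-divides `b` in the positive monoid: `b = c a` with `c ∈ A_S⁺`. -/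
def rdvd (M : CoxeterMatrix B) (a b : Artin M) : Prop :=
  ∃ c ∈ posMon M, c * a = b

/-- `d` is the least common multiple `Δ_X` of `X` in `A_X⁺` (for left-divisibility). -/
def IsDelta (M : CoxeterMatrix B) (X : Set B) (d : Artin M) : Prop :=
  d ∈ posMonOn M X ∧
  (∀ s ∈ X, ∃ c ∈ posMonOn M X, gen M s * c = d) ∧
  ∀ m ∈ posMonOn M X, (∀ s ∈ X, ∃ c ∈ posMonOn M X, gen M s * c = m) →
    ∃ c ∈ posMonOn M X, d * c = m

/-- The subset `Xg = {σ_x g : x ∈ X}` of `A_S`. -/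
def leftMul (M : CoxeterMatrix B) (X : Set B) (g : Artin M) : Set (Artin M) :=
  (fun x => gen M x * g) '' X

/-- The subset `gX = {g σ_x : x ∈ X}` of `A_S`. -/
def rightMul (M : CoxeterMatrix B) (X : Set B) (g : Artin M) : Set (Artin M) :=
  (fun x => g * gen M x) '' X

/-- `Conj(S;X,Y) = {g ∈ A_S : gX = Yg}`. -/
def conjSet (M : CoxeterMatrix B) (X Y : Set B) : Set (Artin M) :=
  { g | rightMul M X g = leftMul M Y g }

/-- `Conj⁺(S;X,Y) = {g ∈ A_S⁺ : gX = Yg}`. -/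
def conjPos (M : CoxeterMatrix B) (X Y : Set B) : Set (Artin M) :=
  { g | g ∈ posMon M ∧ rightMul M X g = leftMul M Y g }

/-- The quasi-centralizer `QZ_{A_S}(A_X) = {g ∈ A_S : gX = Xg}`. -/
def QZset (M : CoxeterMatrix B) (X : Set B) : Set (Artin M) :=
  conjSet M X X

/-- The indecomposable component of `Z` containing `t` (vertices of `Z` joined to `t`
by a path of edges `m_{a,b} ≠ 2` in the Coxeter diagram on `Z`). -/
def comp (M : CoxeterMatrix B) (Z : Set B) (t : B) : Set B :=
  { s ∈ Z | Relation.ReflTransGen (fun a b => a ∈ Z ∧ b ∈ Z ∧ a ≠ b ∧ M a b ≠ 2) t s }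

/-- `Z` is indecomposable: it admits no nontrivial partition `Z = Z₁ ∪ Z₂` with
`m_{a,b} = 2` for `a ∈ Z₁`, `b ∈ Z₂`. -/
def Indecomp (M : CoxeterMatrix B) (Z : Set B) : Prop :=
  ¬ ∃ Z₁ Z₂ : Set B, Z₁.Nonempty ∧ Z₂.Nonempty ∧ Z₁ ∪ Z₂ = Z ∧ Disjoint Z₁ Z₂ ∧
      ∀ a ∈ Z₁, ∀ b ∈ Z₂, M a b = 2

/-- `g` is an elementary positive `Y`-ribbon-`X`: `g = d_{X,t}` for some `t ∈ S` with
`X(t)` of spherical type, where `d_{X,t} = Δ_{X(t)}` if `t ∈ X` and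
`d_{X,t} = Δ_{X(t)} Δ_{X(t)∖{t}}⁻¹` otherwise, and `Y ⊆ X ∪ {t}` satisfies `Yg = gX`. -/
def IsElemRibbon (M : CoxeterMatrix B) (X Y : Set B) (g : Artin M) : Prop :=
  ∃ t : B, IsSpherical M (comp M (X ∪ {t}) t) ∧
    ((t ∈ X ∧ IsDelta M (comp M (X ∪ {t}) t) g) ∨
      (t ∉ X ∧ ∃ d₁ d₂ : Artin M, IsDelta M (comp M (X ∪ {t}) t) d₁ ∧
        IsDelta M ((comp M (X ∪ {t}) t) \ {t}) d₂ ∧ g = d₁ * d₂⁻¹)) ∧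
    Y ⊆ X ∪ {t} ∧ leftMul M Y g = rightMul M X g

/-- `g` is a positive `Y`-ribbon-`X`: a product `g = g_n ⋯ g_1` of elementary positive
`X_i`-ribbons-`X_{i-1}` with `X_0 = X`, `X_n = Y`. -/
inductive IsRibbon (M : CoxeterMatrix B) : Set B → Set B → Artin M → Prop
  | nil (X : Set B) : IsRibbon M X X 1
  | cons {X Y Z : Set B} {g h : Artin M} :
      IsRibbon M X Y g → IsElemRibbon M Y Z h → IsRibbon M X Z (h * g)

/-- `g` is `X`-reduced: no element of `X` left-divides `g`. -/
def lreduced (M : CoxeterMatrix B) (X : Set B) (g : Artin M) : Prop :=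
  ∀ s ∈ X, ¬ ldvd M (gen M s) g

/-- `g` is reduced-`X`: no element of `X` right-divides `g`. -/
def rreduced (M : CoxeterMatrix B) (X : Set B) (g : Artin M) : Prop :=
  ∀ s ∈ X, ¬ rdvd M (gen M s) g

/-- The set `H_X` of elements `g₁ g₂⁻¹` where `g₁, g₂` are `X`-reduced positive
`X`-ribbons-`X`. -/
def HXset (M : CoxeterMatrix B) (X : Set B) : Set (Artin M) :=
  { g | ∃ g₁ g₂ : Artin M, IsRibbon M X X g₁ ∧ lreduced M X g₁ ∧
      IsRibbon M X X g₂ ∧ lreduced M X g₂ ∧ g = g₁ * g₂⁻¹ }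

/-- The length of a positive element (the common length of its expressions as words
in the generators; junk value `0` outside of `A_S⁺`). -/
noncomputable def len (M : CoxeterMatrix B) (g : Artin M) : ℕ :=
  sInf { n | ∃ l : List B, l.length = n ∧ (l.map (gen M)).prod = g }

/-- The length of an element of the Coxeter group `W_S`. -/
noncomputable def wlen (M : CoxeterMatrix B) (w : M.Group) : ℕ :=
  sInf { n | ∃ l : List B, l.length = n ∧ (l.map M.simple).prod = w }

/-- `g ∈ A_{S,red}`: `g` is positive and has the same length as its image in `W_S`. -/
def Red (M : CoxeterMatrix B) (g : Artin M) : Prop :=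
  g ∈ posMon M ∧ len M g = wlen M (proj M g)

/-- `C` is a simple `s`-chain-`u`: either `C = 1` and `s = u`, or
`C = tst⋯` (`k` letters, `k < m_{s,t}`) with `u ∈ {s,t}` and `C·u = tst⋯` (`k+1` letters). -/
def IsSimpleChain (M : CoxeterMatrix B) (s u : B) (C : Artin M) : Prop :=
  (C = 1 ∧ s = u) ∨
  ∃ t : B, t ≠ s ∧ (u = s ∨ u = t) ∧ ∃ k : ℕ,
    (M s t = 0 ∨ k < M s t) ∧
    C = ((altList t s k).map (gen M)).prod ∧
    C * gen M u = ((altList t s (k + 1)).map (gen M)).prod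

/-- `C` is an `s`-chain-`t`: a product `C₁ ⋯ C_k` of simple chains composing from
origin `s` to target `t`. -/
inductive IsChain (M : CoxeterMatrix B) : B → B → Artin M → Prop
  | single {s u : B} {C : Artin M} : IsSimpleChain M s u C → IsChain M s u C
  | comp {s u v : B} {C D : Artin M} :
      IsChain M s u C → IsSimpleChain M u v D → IsChain M s v (C * D)

section Coxeter

variable {W : Type*} [Group W] {M : CoxeterMatrix B} (cs : CoxeterSystem M W)

open Classical in
/-- The signed conjugation by a simple reflection: `(x, e)` is sent to `(s x s, e + [x = s])`. -/
noncomputable def signedSimple (i : B) : Function.End (W × ZMod 2) := fun p =>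
  (cs.simple i * p.1 * cs.simple i, p.2 + if p.1 = cs.simple i then 1 else 0)

open Classical in
theorem signedSimple_mul_pow (i j : B) (n : ℕ) (p : W × ZMod 2) :
    ((signedSimple cs i * signedSimple cs j) ^ n) p =
      ((cs.simple i * cs.simple j) ^ n * p.1 * ((cs.simple i * cs.simple j) ^ n)⁻¹,
        p.2 + ∑ k ∈ Finset.range (2 * n),
          if p.1 = cs.simple j * (cs.simple i * cs.simple j) ^ k then 1 else 0) := by
  induction n generalizing p with
  | zero =>
    change p = _
    simp
  | succ n ih =>
    rw [pow_succ]
    change ((signedSimple cs i * signedSimple cs j) ^ n)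
      (signedSimple cs i (signedSimple cs j p)) = _
    rw [ih]
    have hj : cs.simple j * cs.simple j = 1 := cs.simple_mul_simple_self j
    have hi : cs.simple i * cs.simple i = 1 := cs.simple_mul_simple_self i
    have hji : cs.simple j * p.1 * cs.simple j = cs.simple i ↔
        p.1 = cs.simple j * (cs.simple i * cs.simple j) ^ 1 := by
      constructor
      · intro h
        rw [pow_one, ← h]
        simp [mul_assoc]
      · intro h
        rw [h]
        simp [mul_assoc]
    have hk : ∀ k : ℕ, cs.simple i * (cs.simple j * p.1 * cs.simple j) * cs.simple i =
          cs.simple j * (cs.simple i * cs.simple j) ^ k ↔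
        p.1 = cs.simple j * (cs.simple i * cs.simple j) ^ (k + 1 + 1) := by
      intro k
      rw [pow_succ, pow_succ']
      constructor
      · intro h
        have : p.1 = cs.simple j * (cs.simple i *
            (cs.simple i * (cs.simple j * p.1 * cs.simple j) * cs.simple i) * cs.simple i)
              * cs.simple j := by
          simp [mul_assoc]
        rw [this, h]
        simp [mul_assoc]
      · intro h
        rw [h]
        simp [mul_assoc]
    refine Prod.ext ?_ ?_
    · simp [signedSimple, pow_succ, mul_assoc]
    · simp only [signedSimple, hji, hk]
      rw [show 2 * (n + 1) = 2 * n + 1 + 1 by ring, Finset.sum_range_succ', Finset.sum_range_succ']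
      simp only [pow_zero, mul_one, zero_add]
      ring

theorem isLiftable_signedSimple : M.IsLiftable (signedSimple cs) := by
  classical
  intro i j
  funext p
  rw [signedSimple_mul_pow, cs.simple_mul_simple_pow, two_mul, Finset.sum_range_add]
  change _ = p
  refine Prod.ext (by simp) ?_
  simp only [pow_add, cs.simple_mul_simple_pow, one_mul]
  rw [CharTwo.add_self_eq_zero, add_zero]

/-- The action of `W` on `W × ZMod 2` recording inversions. -/
noncomputable def signedAction : W →* Function.End (W × ZMod 2) :=
  cs.lift ⟨signedSimple cs, isLiftable_signedSimple cs⟩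

theorem signedAction_simple (i : B) : signedAction cs (cs.simple i) = signedSimple cs i :=
  cs.lift_apply_simple _ i

/-- The parity with which `x` occurs as a right inversion of `w`. -/
noncomputable def invParity (w x : W) : ZMod 2 := (signedAction cs w (x, 0)).2

theorem signedAction_apply (w : W) (p : W × ZMod 2) :
    signedAction cs w p = (w * p.1 * w⁻¹, p.2 + invParity cs w p.1) := by
  classical
  induction w using cs.simple_induction_left generalizing p with
  | one =>
    simp only [invParity, map_one]
    change p = (1 * p.1 * 1⁻¹, p.2 + 0)
    simp
  | mul_simple_left w i ih =>
    simp only [invParity, map_mul]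
    change signedAction cs (cs.simple i) (signedAction cs w p) =
      (_, p.2 + (signedAction cs (cs.simple i) (signedAction cs w (p.1, 0))).2)
    rw [ih p, ih (p.1, 0), signedAction_simple]
    simp [signedSimple, mul_assoc, add_assoc]

theorem invParity_mul (w w' x : W) :
    invParity cs (w * w') x = invParity cs w' x + invParity cs w (w' * x * w'⁻¹) := by
  rw [invParity, map_mul]
  change (signedAction cs w (signedAction cs w' (x, 0))).2 = _
  rw [signedAction_apply cs w' (x, 0), signedAction_apply]
  simp

theorem invParity_one (x : W) : invParity cs 1 x = 0 := by
  rw [invParity, map_one]; rfl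

open Classical in
theorem invParity_simple (i : B) (x : W) :
    invParity cs (cs.simple i) x = if x = cs.simple i then 1 else 0 := by
  rw [invParity, signedAction_simple]
  simp [signedSimple]

theorem invParity_self {r : W} (hr : cs.IsReflection r) : invParity cs r r = 1 := by
  obtain ⟨u, i, rfl⟩ := hr
  have h := invParity_mul cs u u⁻¹ (u * cs.simple i * u⁻¹)
  rw [mul_inv_cancel, invParity_one] at h
  rw [mul_assoc u, invParity_mul, invParity_mul]
  have e : u⁻¹ * (u * (cs.simple i * u⁻¹)) * u⁻¹⁻¹ = cs.simple i := by group
  have e' : u⁻¹ * (u * cs.simple i * u⁻¹) * u⁻¹⁻¹ = cs.simple i := by group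
  have e2 : cs.simple i * u⁻¹ * (u * (cs.simple i * u⁻¹)) * (cs.simple i * u⁻¹)⁻¹ =
    cs.simple i := by simp [mul_assoc]
  rw [e'] at h
  rw [e, e2, invParity_simple, if_pos rfl, ← mul_assoc u, add_right_comm, ← h, zero_add]

theorem mem_rightInvSeq_of_invParity_ne_zero (ω : List B) (x : W)
    (h : invParity cs (cs.wordProd ω) x ≠ 0) : x ∈ cs.rightInvSeq ω := by
  classical
  induction ω with
  | nil => simp [invParity_one] at h
  | cons i ω ih =>
    rw [cs.wordProd_cons, invParity_mul, invParity_simple] at h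
    rw [CoxeterSystem.rightInvSeq, List.mem_cons]
    by_cases hx : cs.wordProd ω * x * (cs.wordProd ω)⁻¹ = cs.simple i
    · left
      rw [← hx]; group
    · right
      rw [if_neg hx, add_zero] at h
      exact ih h

theorem length_mul_lt_of_invParity_ne_zero {w x : W} (h : invParity cs w x ≠ 0) :
    cs.length (w * x) < cs.length w := by
  obtain ⟨ω, hω, rfl⟩ := cs.exists_isReduced w
  exact (cs.isRightInversion_of_mem_rightInvSeq hω
    (mem_rightInvSeq_of_invParity_ne_zero cs ω x h)).2

theorem length_mul_lt_iff_invParity {r : W} (hr : cs.IsReflection r) (w : W) :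
    cs.length (w * r) < cs.length w ↔ invParity cs w r = 1 := by
  constructor
  · intro h
    by_contra hne
    have h0 : invParity cs w r = 0 := by
      generalize invParity cs w r = a at hne
      revert a; decide
    have h1 : invParity cs (w * r) r ≠ 0 := by
      rw [invParity_mul, invParity_self cs hr]
      rw [show r * r * r⁻¹ = r by group, h0]
      decide
    have h2 := length_mul_lt_of_invParity_ne_zero cs h1
    rw [mul_assoc, hr.mul_self, mul_one] at h2
    omega
  · intro h
    apply length_mul_lt_of_invParity_ne_zero
    rw [h]; decide

theorem length_reflection_mul_lt_iff {r : W} (hr : cs.IsReflection r) (w : W) :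
    cs.length (r * w) < cs.length w ↔ invParity cs w⁻¹ r = 1 := by
  rw [← length_mul_lt_iff_invParity cs hr, ← cs.length_inv (r * w), ← cs.length_inv w, mul_inv_rev,
    hr.inv]

/-- The strong exchange property: `r` is a left inversion of `x y` iff exactly one of
`r` is a left inversion of `x` and `x⁻¹ r x` is a left inversion of `y` holds. -/
theorem length_reflection_mul_mul_lt_iff {r : W} (hr : cs.IsReflection r) (x y : W) :
    cs.length (r * (x * y)) < cs.length (x * y) ↔
      ¬ (cs.length (r * x) < cs.length x ↔
        cs.length (x⁻¹ * r * x * y) < cs.length y) := by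
  have hr' : cs.IsReflection (x⁻¹ * r * x) := by simpa using hr.conj x⁻¹
  rw [length_reflection_mul_lt_iff cs hr, length_reflection_mul_lt_iff cs hr,
    length_reflection_mul_lt_iff cs hr', mul_inv_rev, invParity_mul, inv_inv]
  generalize invParity cs x⁻¹ r = a
  generalize invParity cs y⁻¹ (x⁻¹ * r * x) = b
  revert a b; decide

/-- The left inversions of a word belong to its left inversion sequence. -/
theorem mem_leftInvSeq_of_length_lt (ω : List B) {r : W} (hr : cs.IsReflection r)
    (h : cs.length (r * cs.wordProd ω) < cs.length (cs.wordProd ω)) : r ∈ cs.leftInvSeq ω := by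
  rw [length_reflection_mul_lt_iff cs hr, ← cs.wordProd_reverse] at h
  have := mem_rightInvSeq_of_invParity_ne_zero cs ω.reverse r (by rw [h]; decide)
  rwa [cs.rightInvSeq_reverse, List.mem_reverse] at this

end Coxeter

section Geometric

open Polynomial.Chebyshev

/-- The Cartan coefficient `-2 cos (π / m_{s,t})`. -/
noncomputable def cartanCoeff (M : CoxeterMatrix B) (s t : B) : ℝ :=
  -2 * Real.cos (Real.pi / M s t)

theorem cartanCoeff_self (M : CoxeterMatrix B) (s : B) : cartanCoeff M s s = 2 := by
  simp [cartanCoeff]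

theorem cartanCoeff_comm (M : CoxeterMatrix B) (s t : B) :
    cartanCoeff M s t = cartanCoeff M t s := by
  rw [cartanCoeff, cartanCoeff, M.symmetric]

/-- The simple root of index `s`. -/
noncomputable def sroot (s : B) : B →₀ ℝ := Finsupp.single s 1

/-- The simple coroot of index `s`. -/
noncomputable def coroot (M : CoxeterMatrix B) (s : B) : Module.Dual ℝ (B →₀ ℝ) :=
  Finsupp.linearCombination ℝ (cartanCoeff M s)

theorem coroot_sroot (M : CoxeterMatrix B) (s t : B) :
    coroot M s (sroot t) = cartanCoeff M s t := by
  simp [coroot, sroot]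

theorem coroot_sroot_self (M : CoxeterMatrix B) (s : B) : coroot M s (sroot s) = 2 := by
  rw [coroot_sroot, cartanCoeff_self]

/-- The reflection in the simple root `s`. -/
noncomputable def sreflection (M : CoxeterMatrix B) (s : B) : (B →₀ ℝ) ≃ₗ[ℝ] (B →₀ ℝ) :=
  Module.reflection (coroot_sroot_self M s)

theorem cartanCoeff_mul_sub_two (M : CoxeterMatrix B) (s t : B) :
    cartanCoeff M s t * cartanCoeff M t s - 2 = 2 * Real.cos (2 * Real.pi / M s t) := by
  rw [cartanCoeff_comm M t s, cartanCoeff, mul_div_assoc, Real.cos_two_mul]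
  ring

theorem sin_two_pi_div_pos {m : ℕ} (hm : 3 ≤ m) : 0 < Real.sin (2 * Real.pi / m) := by
  have hm' : (3 : ℝ) ≤ m := by exact_mod_cast hm
  have := Real.pi_pos
  apply Real.sin_pos_of_pos_of_lt_pi
  · positivity
  · rw [div_lt_iff₀ (by linarith)]
    nlinarith

theorem isLiftable_sreflection (M : CoxeterMatrix B) : M.IsLiftable (sreflection M) := by
  intro s t
  have h2 := Module.reflection_mul_reflection_pow_apply (coroot_sroot_self M s)
    (coroot_sroot_self M t) (M s t)
  simp only [coroot_sroot, cartanCoeff_mul_sub_two] at h2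
  ext1 z
  change ((Module.reflection (coroot_sroot_self M s) * Module.reflection (coroot_sroot_self M t)) ^
    M s t) z = z
  generalize hm : M s t = m at *
  rcases (show m = 0 ∨ m = 1 ∨ m = 2 ∨ 3 ≤ m by omega) with h | h | h | h
  · subst h; rw [pow_zero]; rfl
  · subst h
    have : s = t := by
      by_contra hst
      exact M.off_diagonal s t hst hm
    subst this
    rw [pow_one, LinearEquiv.mul_apply]
    exact Module.involutive_reflection (coroot_sroot_self M s) z
  · subst h
    have h0 : cartanCoeff M s t = 0 := by simp [cartanCoeff, hm]
    have h0' : cartanCoeff M t s = 0 := by rw [cartanCoeff_comm, h0]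
    rw [h2 z, h0, h0']
    have : 2 * Real.cos (2 * Real.pi / (2 : ℕ)) = -2 := by
      rw [show 2 * Real.pi / ((2 : ℕ) : ℝ) = Real.pi by push_cast; ring, Real.cos_pi]; norm_num
    rw [this]
    norm_num
    module
  · have hs := sin_two_pi_div_pos h
    have hm' : (m : ℝ) ≠ 0 := by positivity
    have key := fun n : ℤ => S_two_mul_real_cos (2 * Real.pi / m) n
    rw [h2 z]
    rcases Nat.even_or_odd' m with ⟨p, hp | hp⟩
    · have e1 : ((m : ℤ) - 2) / 2 = p - 1 := by omega
      have e2 : ((m : ℤ) - 1) / 2 = p - 1 := by omega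
      have hz : (S ℝ ((p : ℤ) - 1)).eval (2 * Real.cos (2 * Real.pi / m)) = 0 := by
        have := key (p - 1)
        have e : (((p : ℤ) - 1 : ℤ) + 1 : ℝ) * (2 * Real.pi / m) = Real.pi := by
          have hp' : (p : ℝ) ≠ 0 := by
            have : p ≠ 0 := by omega
            exact_mod_cast this
          rw [hp]; push_cast; field_simp; ring
        rw [e, Real.sin_pi] at this
        exact (mul_eq_zero.mp this).resolve_right hs.ne'
      rw [e1, e2, hz]
      simp
    · have e1 : ((m : ℤ) - 2) / 2 = p - 1 := by omega
      have e2 : ((m : ℤ) - 1) / 2 = p := by omega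
      have e3 : ((m : ℤ) - 3) / 2 = p - 1 := by omega
      have e4 : (m : ℤ) / 2 = p := by omega
      have hz : (S ℝ (p : ℤ)).eval (2 * Real.cos (2 * Real.pi / m)) +
          (S ℝ ((p : ℤ) - 1)).eval (2 * Real.cos (2 * Real.pi / m)) = 0 := by
        have k1 := key p
        have k2 := key (p - 1)
        have e : (((p : ℤ)) + 1 : ℝ) * (2 * Real.pi / m) =
            2 * Real.pi - (((p : ℤ) - 1 : ℤ) + 1 : ℝ) * (2 * Real.pi / m) := by
          rw [hp]; rw [hp] at hm'; push_cast at hm' ⊢; field_simp; ring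
        rw [e, Real.sin_two_pi_sub] at k1
        have : ((S ℝ (p : ℤ)).eval (2 * Real.cos (2 * Real.pi / m)) +
          (S ℝ ((p : ℤ) - 1)).eval (2 * Real.cos (2 * Real.pi / m))) *
            Real.sin (2 * Real.pi / m) = 0 := by
          rw [add_mul, k1, k2]; ring
        exact (mul_eq_zero.mp this).resolve_right hs.ne'
      rw [e1, e2, e3, e4, hz]
      simp

variable {W : Type*} [Group W] {M : CoxeterMatrix B} (cs : CoxeterSystem M W)

/-- The geometric representation of a Coxeter group. -/
noncomputable def geomRep : W →* ((B →₀ ℝ) ≃ₗ[ℝ] (B →₀ ℝ)) :=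
  cs.lift ⟨sreflection M, isLiftable_sreflection M⟩

theorem geomRep_simple (i : B) : geomRep cs (cs.simple i) = sreflection M i :=
  cs.lift_apply_simple _ i

/-- In a Coxeter group, the order of `s t` is exactly `m_{s,t}`. -/
theorem dvd_of_simple_mul_simple_pow_eq_one {s t : B} (hst : s ≠ t) {n : ℕ} (hn : 0 < n)
    (h : (cs.simple s * cs.simple t) ^ n = 1) : M s t ≠ 0 ∧ M s t ∣ n := by
  have h1 := congrArg (fun w => geomRep cs w (sroot s)) h
  simp only [map_pow, map_mul, geomRep_simple, map_one] at h1
  have h2 := Module.reflection_mul_reflection_pow_apply_self (coroot_sroot_self M s)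
    (coroot_sroot_self M t) n _ rfl
  simp only [coroot_sroot, cartanCoeff_mul_sub_two] at h2
  have h3 : sroot s = _ := h1.symm.trans h2
  have ha := DFunLike.congr_fun h3 s
  have hb := DFunLike.congr_fun h3 t
  simp only [sroot, Finsupp.add_apply, Finsupp.smul_apply, Finsupp.single_eq_same, smul_eq_mul,
    Finsupp.single_eq_of_ne hst, Finsupp.single_eq_of_ne hst.symm, mul_zero, add_zero, zero_add,
    mul_one] at ha hb
  generalize hm : M s t = m at *
  have hmt : M t s = m := by rw [M.symmetric, hm]
  rcases (show m = 0 ∨ m = 1 ∨ m = 2 ∨ 3 ≤ m by omega) with h | h | h | h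
  · exfalso
    subst h
    simp only [cartanCoeff, hmt] at hb
    simp at hb
    omega
  · exact absurd (hm.trans h) (M.off_diagonal s t hst)
  · refine ⟨by omega, ?_⟩
    subst h
    by_contra hdvd
    have hodd : n % 2 = 1 := by omega
    have h4 : (cs.simple s * cs.simple t) ^ 1 = 1 := by
      have e := cs.simple_mul_simple_pow s t
      rw [hm] at e
      have : (cs.simple s * cs.simple t) ^ (2 * (n / 2) + n % 2) = 1 := by
        rw [Nat.div_add_mod]; assumption
      rwa [pow_add, pow_mul, e, one_pow, one_mul, hodd] at this
    have h5 := congrArg (fun w => geomRep cs w (sroot s)) h4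
    simp only [map_pow, map_mul, geomRep_simple, map_one] at h5
    have h6 := Module.reflection_mul_reflection_pow_apply_self (coroot_sroot_self M s)
      (coroot_sroot_self M t) 1 _ rfl
    simp only [coroot_sroot, cartanCoeff_mul_sub_two, hm] at h6
    have h7 : sroot s = _ := h5.symm.trans h6
    have := DFunLike.congr_fun h7 s
    rw [show 2 * Real.pi / ((2 : ℕ) : ℝ) = Real.pi by push_cast; ring, Real.cos_pi] at this
    simp [sroot, Finsupp.single_eq_of_ne hst] at this
  · refine ⟨by omega, ?_⟩
    have hs := sin_two_pi_div_pos h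
    have hm' : (3 : ℝ) ≤ m := by exact_mod_cast h
    have hc : cartanCoeff M t s ≠ 0 := by
      rw [cartanCoeff, hmt]
      have := Real.pi_pos
      have : 0 < Real.cos (Real.pi / m) := by
        apply Real.cos_pos_of_mem_Ioo
        constructor
        · have : 0 < Real.pi / m := by positivity
          linarith
        · rw [div_lt_div_iff_of_pos_left] <;> linarith
      exact (mul_neg_of_neg_of_pos (by norm_num) this).ne
    have hS : (S ℝ ((n : ℤ) - 1)).eval (2 * Real.cos (2 * Real.pi / m)) = 0 :=
      (mul_eq_zero.mp hb.symm).resolve_right (neg_ne_zero.mpr hc)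
    rw [hS, add_zero] at ha
    have k1 := S_two_mul_real_cos (2 * Real.pi / m) n
    have k2 := S_two_mul_real_cos (2 * Real.pi / m) (n - 1)
    rw [hS, zero_mul] at k2
    rw [← ha, one_mul, add_mul, Real.sin_add, one_mul] at k1
    push_cast at k1 k2
    rw [show (n : ℝ) - 1 + 1 = n by ring] at k2
    rw [← k2, zero_mul, zero_add] at k1
    have hcos : Real.cos (n * (2 * Real.pi / m)) = 1 :=
      mul_right_cancel₀ hs.ne' (by rw [one_mul]; exact k1.symm)
    obtain ⟨k, hk⟩ := (Real.cos_eq_one_iff _).mp hcos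
    have hpi := Real.pi_pos
    have : (k * m : ℝ) = n := by
      have h0 : (m : ℝ) ≠ 0 := by linarith
      field_simp at hk
      nlinarith
    have : (k * m : ℤ) = n := by exact_mod_cast this
    have : (m : ℤ) ∣ n := ⟨k, by rw [← this, mul_comm]⟩
    exact_mod_cast this

end Geometric

section WeakOrder

variable {W : Type*} [Group W] {M : CoxeterMatrix B} (cs : CoxeterSystem M W)

theorem coxeterMatrix_ne_zero_of_finite (cs : CoxeterSystem M W) [Finite W] {s t : B}
    (hst : s ≠ t) : M s t ≠ 0 := by
  obtain ⟨n, hn, h⟩ := (isOfFinOrder_of_finite (cs.simple s * cs.simple t)).exists_pow_eq_one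
  exact (dvd_of_simple_mul_simple_pow_eq_one cs hst hn h).1

theorem mem_leftInvSeq_altList {s t : B} {k : ℕ} {r : W}
    (h : r ∈ cs.leftInvSeq (altList s t k)) :
    ∃ j < k, r = (cs.simple s * cs.simple t) ^ j * cs.simple s := by
  induction k generalizing s t r with
  | zero => simp [altList] at h
  | succ k ih =>
    rw [altList, CoxeterSystem.leftInvSeq, List.mem_cons, List.mem_map] at h
    rcases h with rfl | ⟨r, hr, rfl⟩
    · exact ⟨0, k.succ_pos, by simp⟩
    · obtain ⟨j, hj, rfl⟩ := ih hr
      refine ⟨j + 1, by omega, ?_⟩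
      have : ∀ j : ℕ, cs.simple s * (cs.simple t * cs.simple s) ^ j * cs.simple t =
          (cs.simple s * cs.simple t) ^ (j + 1) := by
        intro j
        induction j with
        | zero => simp
        | succ j ih => rw [pow_succ _ (j + 1), ← ih, pow_succ]; simp [mul_assoc]
      rw [← this]
      simp [mul_assoc]

theorem length_wordProd_altList {s t : B} (hst : s ≠ t) {k : ℕ} (hk : M s t = 0 ∨ k ≤ M s t) :
    cs.length (cs.wordProd (altList s t k)) = k := by
  induction k generalizing s t with
  | zero => simp [altList]
  | succ k ih =>
    have hsym := M.symmetric s t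
    have h1 := ih hst.symm (by omega)
    rw [altList, cs.wordProd_cons]
    rcases cs.length_simple_mul (cs.wordProd (altList t s k)) s with h | h
    · omega
    · exfalso
      obtain ⟨j, hj, hr⟩ := mem_leftInvSeq_altList cs
        (mem_leftInvSeq_of_length_lt cs (altList t s k) (cs.isReflection_simple s) (by omega))
      have h2 : (cs.simple t * cs.simple s) ^ (j + 1) = 1 := by
        rw [pow_succ, ← mul_assoc, ← hr, cs.simple_mul_simple_self]
      obtain ⟨h3, h4⟩ := dvd_of_simple_mul_simple_pow_eq_one cs hst.symm j.succ_pos h2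
      have := Nat.le_of_dvd j.succ_pos h4
      omega

theorem length_altList (s t : B) (k : ℕ) : (altList s t k).length = k := by
  induction k generalizing s t with
  | zero => rfl
  | succ k ih => rw [altList, List.length_cons, ih]

theorem wordProd_altList_comm (s t : B) :
    cs.wordProd (altList s t (M s t)) = cs.wordProd (altList t s (M s t)) := by
  rw [altList_eq_reverse_alternatingWord, altList_eq_reverse_alternatingWord,
    cs.wordProd_reverse, cs.wordProd_reverse]
  have hb := cs.wordProd_braidWord_eq t s
  rw [CoxeterSystem.braidWord, CoxeterSystem.braidWord, M.symmetric t s] at hb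
  rw [hb]

/-- The weak order on a Coxeter group. -/
def wle (u w : W) : Prop := cs.length w = cs.length u + cs.length (u⁻¹ * w)

theorem wle_mul_iff (u v : W) : wle cs u (u * v) ↔
    cs.length (u * v) = cs.length u + cs.length v := by
  rw [wle, inv_mul_cancel_left]

theorem wle_refl (u : W) : wle cs u u := by simp [wle]

theorem one_wle (u : W) : wle cs 1 u := by simp [wle]

theorem wle_trans {u v w : W} (h1 : wle cs u v) (h2 : wle cs v w) : wle cs u w := by
  unfold wle at *
  have h3 := cs.length_mul_le u (u⁻¹ * w)
  have h4 := cs.length_mul_le (u⁻¹ * v) (v⁻¹ * w)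
  rw [mul_inv_cancel_left] at h3
  rw [show u⁻¹ * v * (v⁻¹ * w) = u⁻¹ * w by group] at h4
  omega

theorem wle_antisymm {u v : W} (h1 : wle cs u v) (h2 : wle cs v u) : u = v := by
  unfold wle at *
  have : cs.length (u⁻¹ * v) = 0 := by omega
  rw [cs.length_eq_zero_iff, inv_mul_eq_one] at this
  exact this

/-- Left translation by `u` is an order embedding on elements with which `u` adds lengths. -/
theorem mul_wle_mul_iff {u a b : W} (ha : cs.length (u * a) = cs.length u + cs.length a)
    (hb : cs.length (u * b) = cs.length u + cs.length b) :
    wle cs (u * a) (u * b) ↔ wle cs a b := by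
  unfold wle
  rw [show (u * a)⁻¹ * (u * b) = a⁻¹ * b by group]
  omega

theorem length_mul_of_wle {u a b : W} (hab : wle cs a b)
    (hb : cs.length (u * b) = cs.length u + cs.length b) :
    cs.length (u * a) = cs.length u + cs.length a := by
  unfold wle at hab
  have h1 := cs.length_mul_le u a
  have h2 := cs.length_mul_le (u * a) (a⁻¹ * b)
  rw [show u * a * (a⁻¹ * b) = u * b by group] at h2
  omega

/-- If `u ≤ v ≤ w`, then `u⁻¹ v ≤ u⁻¹ w`. -/
theorem inv_mul_wle {u v w : W} (h1 : wle cs u v) (h2 : wle cs v w) :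
    wle cs (u⁻¹ * v) (u⁻¹ * w) := by
  have h3 := wle_trans cs h1 h2
  unfold wle at *
  rw [show (u⁻¹ * v)⁻¹ * (u⁻¹ * w) = v⁻¹ * w by group]
  omega

theorem simple_wle_iff (s : B) (w : W) :
    wle cs (cs.simple s) w ↔ cs.length (cs.simple s * w) < cs.length w := by
  rw [wle, cs.length_simple, cs.inv_simple]
  rcases cs.length_simple_mul w s with h | h <;> omega

theorem exists_simple_wle {w : W} (hw : w ≠ 1) : ∃ s, wle cs (cs.simple s) w := by
  obtain ⟨i, hi⟩ := cs.exists_leftDescent_of_ne_one hw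
  exact ⟨i, (simple_wle_iff cs i w).mpr hi⟩

/-- If `u < w` then some cover `u s` of `u` satisfies `u s ≤ w`. -/
theorem exists_cover {u w : W} (h : wle cs u w) (hne : u ≠ w) :
    ∃ s, cs.length (u * cs.simple s) = cs.length u + 1 ∧ wle cs (u * cs.simple s) w := by
  obtain ⟨s, hs⟩ := exists_simple_wle cs (w := u⁻¹ * w) (by rwa [ne_eq, inv_mul_eq_one])
  have h1 : cs.length (u * (u⁻¹ * w)) = cs.length u + cs.length (u⁻¹ * w) := by
    rw [mul_inv_cancel_left]; exact h
  have h2 := length_mul_of_wle cs hs h1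
  have h3 := (mul_wle_mul_iff cs h2 h1).mpr hs
  rw [mul_inv_cancel_left] at h3
  rw [cs.length_simple] at h2
  exact ⟨s, h2, h3⟩

/-- A word in `s, t` of the rank two parabolic subgroup. -/
theorem exists_altList_of_word {s t : B} (hm : M s t ≠ 0) (l : List B)
    (hl : ∀ x ∈ l, x = s ∨ x = t) :
    ∃ k ≤ M s t, cs.wordProd l = cs.wordProd (altList s t k) ∨
      cs.wordProd l = cs.wordProd (altList t s k) := by
  have key : ∀ a b : B, M a b = M s t → ∀ k ≤ M s t,
      ∃ j ≤ M s t, cs.simple a * cs.wordProd (altList a b k) = cs.wordProd (altList a b j) ∨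
        cs.simple a * cs.wordProd (altList a b k) = cs.wordProd (altList b a j) := by
    intro a b hab k hk
    rcases k with _ | k
    · exact ⟨1, by omega, Or.inl (by simp [altList])⟩
    · exact ⟨k, by omega, Or.inr (by rw [altList, cs.wordProd_cons,
        cs.simple_mul_simple_cancel_left])⟩
  have key2 : ∀ a b : B, M a b = M s t → ∀ k ≤ M s t,
      ∃ j ≤ M s t, cs.simple a * cs.wordProd (altList b a k) = cs.wordProd (altList a b j) ∨
        cs.simple a * cs.wordProd (altList b a k) = cs.wordProd (altList b a j) := by
    intro a b hab k hk
    rcases Nat.lt_or_ge k (M s t) with h | h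
    · exact ⟨k + 1, by omega, Or.inl (by rw [altList, cs.wordProd_cons])⟩
    · obtain rfl : k = M s t := by omega
      have := wordProd_altList_comm cs a b
      rw [hab] at this
      rw [← this]
      exact key a b hab _ le_rfl
  induction l with
  | nil => exact ⟨0, by omega, Or.inl rfl⟩
  | cons x l ih =>
    obtain ⟨k, hk, h⟩ := ih (fun y hy => hl y (List.mem_cons_of_mem _ hy))
    rw [cs.wordProd_cons]
    have hsym : M t s = M s t := M.symmetric t s
    rcases hl x (by simp) with rfl | rfl <;> rcases h with h | h <;> rw [h]
    · exact key x t rfl k hk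
    · exact key2 x t rfl k hk
    · obtain ⟨j, hj, h⟩ := key2 x s hsym k hk
      exact ⟨j, hj, h.symm⟩
    · obtain ⟨j, hj, h⟩ := key x s hsym k hk
      exact ⟨j, hj, h.symm⟩

/-- If `s ≠ t` both lie below `w`, so does the longest element of the dihedral parabolic. -/
theorem altList_wle {s t : B} (hst : s ≠ t) (hm : M s t ≠ 0) {w : W}
    (hs : wle cs (cs.simple s) w) (ht : wle cs (cs.simple t) w) :
    wle cs (cs.wordProd (altList s t (M s t))) w := by
  have hex : ∃ n, ∃ l : List B, (∀ x ∈ l, x = s ∨ x = t) ∧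
      cs.length (cs.wordProd l * w) = n := ⟨_, [], by simp, rfl⟩
  classical
  obtain ⟨l, hl, hln⟩ := Nat.find_spec hex
  have hmin : ∀ l' : List B, (∀ x ∈ l', x = s ∨ x = t) →
      cs.length (cs.wordProd l * w) ≤ cs.length (cs.wordProd l' * w) := by
    intro l' hl'
    rw [hln]
    exact Nat.find_min' hex ⟨l', hl', rfl⟩
  set w' := cs.wordProd l * w with hw'
  have hmin' : ∀ l' : List B, (∀ x ∈ l', x = s ∨ x = t) →
      cs.length w' ≤ cs.length (cs.wordProd l' * w') := by
    intro l' hl'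
    rw [hw', ← mul_assoc, ← cs.wordProd_append]
    refine hmin _ ?_
    intro x hx
    rcases List.mem_append.mp hx with h | h
    · exact hl' x h
    · exact hl x h
  have step : ∀ l' : List B, (∀ x ∈ l', x = s ∨ x = t) → ∀ x, (x = s ∨ x = t) →
      (cs.length (cs.simple x * (cs.wordProd l' * w')) < cs.length (cs.wordProd l' * w') ↔
        cs.length (cs.simple x * cs.wordProd l') < cs.length (cs.wordProd l')) := by
    intro l' hl' x hx
    rw [length_reflection_mul_mul_lt_iff cs (cs.isReflection_simple x)]
    have h := hmin' (l'.reverse ++ x :: l') (by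
      intro y hy
      simp only [List.mem_append, List.mem_reverse, List.mem_cons] at hy
      rcases hy with hy | rfl | hy
      · exact hl' y hy
      · exact hx
      · exact hl' y hy)
    rw [cs.wordProd_append, cs.wordProd_cons, cs.wordProd_reverse, ← mul_assoc (cs.wordProd l')⁻¹]
      at h
    have h' := not_lt.mpr h
    tauto
  have hadd : ∀ l' : List B, (∀ x ∈ l', x = s ∨ x = t) →
      cs.length (cs.wordProd l' * w') = cs.length (cs.wordProd l') + cs.length w' := by
    intro l' hl'
    induction l' with
    | nil => simp
    | cons x l' ih =>
      have ih := ih (fun y hy => hl' y (List.mem_cons_of_mem _ hy))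
      have h := step l' (fun y hy => hl' y (List.mem_cons_of_mem _ hy)) x (hl' x (by simp))
      rw [cs.wordProd_cons, mul_assoc]
      rcases cs.length_simple_mul (cs.wordProd l' * w') x with h1 | h1 <;>
      rcases cs.length_simple_mul (cs.wordProd l') x with h2 | h2 <;> omega
  have hl' : ∀ x ∈ l.reverse, x = s ∨ x = t := by simpa using hl
  have hwe : w = cs.wordProd l.reverse * w' := by rw [hw', cs.wordProd_reverse]; group
  obtain ⟨k, hk, hkl⟩ := exists_altList_of_word cs hm l.reverse hl'
  rw [simple_wle_iff, hwe, step _ hl' _ (Or.inl rfl)] at hs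
  rw [simple_wle_iff, hwe, step _ hl' _ (Or.inr rfl)] at ht
  have hsym : M t s = M s t := M.symmetric t s
  have hkm : k = M s t := by
    by_contra hne
    rcases hkl with h | h
    · rw [h, ← cs.wordProd_cons] at ht
      change cs.length (cs.wordProd (altList t s (k + 1))) < _ at ht
      rw [length_wordProd_altList cs hst.symm (by omega), length_wordProd_altList cs hst
        (by omega)] at ht
      omega
    · rw [h, ← cs.wordProd_cons] at hs
      change cs.length (cs.wordProd (altList s t (k + 1))) < _ at hs
      rw [length_wordProd_altList cs hst.symm (by omega), length_wordProd_altList cs hst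
        (by omega)] at hs
      omega
  subst hkm
  rw [← wordProd_altList_comm, or_self] at hkl
  rw [hwe, hkl, wle_mul_iff, ← hkl]
  exact (hadd _ hl')

/-- A finite Coxeter group has a greatest element for the weak order. -/
theorem exists_longest [Finite W] : ∃ w₀ : W, ∀ v, wle cs v w₀ := by
  obtain ⟨w₀, hw₀⟩ := Finite.exists_max (fun w : W => cs.length w)
  refine ⟨w₀, fun v => ?_⟩
  induction hn : cs.length v generalizing v with
  | zero =>
    rw [cs.length_eq_zero_iff] at hn
    rw [hn]; exact one_wle cs _
  | succ n ih =>
    obtain ⟨s, hs⟩ := cs.exists_rightDescent_of_ne_one (w := v) (by rintro rfl; simp at hn)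
    rw [cs.isRightDescent_iff] at hs
    set v' := v * cs.simple s with hv'
    have hv : v = v' * cs.simple s := by rw [hv', cs.simple_mul_simple_cancel_right]
    have h1 := ih v' (by omega)
    have hr := (cs.isReflection_simple s).conj v'
    have h2 := hr.length_mul_right_ne w₀
    have h3 := hw₀ (v' * cs.simple s * v'⁻¹ * w₀)
    have h4 := length_reflection_mul_mul_lt_iff cs hr v' (v'⁻¹ * w₀)
    rw [mul_inv_cancel_left] at h4
    have h5 := h4.mp (lt_of_le_of_ne h3 h2)
    rw [show v' * cs.simple s * v'⁻¹ * v' = v by rw [hv]; group,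
      show v'⁻¹ * (v' * cs.simple s * v'⁻¹) * v' = cs.simple s by group, ← simple_wle_iff] at h5
    have h6 : wle cs (cs.simple s) (v'⁻¹ * w₀) := by
      by_contra hc
      exact h5 ⟨fun h => by omega, fun h => absurd h hc⟩
    have h7 : cs.length (v' * (v'⁻¹ * w₀)) = cs.length v' + cs.length (v'⁻¹ * w₀) := by
      rw [mul_inv_cancel_left]; exact h1
    have h8 := (mul_wle_mul_iff cs (length_mul_of_wle cs h6 h7) h7).mpr h6
    rwa [mul_inv_cancel_left, ← hv] at h8

/-- A Newman-type lemma: a down-set satisfying the diamond condition has a greatest element. -/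
theorem exists_greatest_of_diamond [Finite W] (P : W → Prop) (h1 : P 1)
    (hpre : ∀ u v, wle cs u v → P v → P u)
    (hdia : ∀ v s t, s ≠ t → cs.length (v * cs.simple s) = cs.length v + 1 →
      cs.length (v * cs.simple t) = cs.length v + 1 → P (v * cs.simple s) → P (v * cs.simple t) →
      ∃ d, P d ∧ wle cs (v * cs.simple s) d ∧ wle cs (v * cs.simple t) d) :
    ∃ g, P g ∧ ∀ x, P x → wle cs x g := by
  obtain ⟨w₀, hw₀⟩ := Finite.exists_max (fun w : W => cs.length w)
  have key : ∀ n v, cs.length w₀ - cs.length v = n → P v →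
      ∃ g, P g ∧ ∀ x, P x → wle cs v x → wle cs x g := by
    intro n
    induction n using Nat.strong_induction_on with
    | _ n ih =>
      intro v hvn hv
      by_cases hex : ∃ s, cs.length (v * cs.simple s) = cs.length v + 1 ∧ P (v * cs.simple s)
      · obtain ⟨s₀, hs₀, hPs₀⟩ := hex
        have hle := hw₀ (v * cs.simple s₀)
        obtain ⟨g, hg, hgx⟩ := ih _ (by omega) (v * cs.simple s₀) rfl hPs₀
        have hcov : ∀ s, cs.length (v * cs.simple s) = cs.length v + 1 →
            wle cs v (v * cs.simple s) := fun s hs => by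
          rw [wle_mul_iff, cs.length_simple, hs]
        refine ⟨g, hg, fun x hx hvx => ?_⟩
        by_cases hxv : v = x
        · subst hxv
          exact wle_trans cs (hcov s₀ hs₀) (hgx _ hPs₀ (wle_refl cs _))
        · obtain ⟨s, hs, hsx⟩ := exists_cover cs hvx hxv
          by_cases hss : s = s₀
          · subst hss
            exact hgx x hx hsx
          · have hPs := hpre _ _ hsx hx
            obtain ⟨d, hd, hsd, hs₀d⟩ := hdia v s s₀ hss hs hs₀ hPs hPs₀
            have hle' := hw₀ (v * cs.simple s)
            obtain ⟨g', hg', hgx'⟩ := ih _ (by omega) (v * cs.simple s) rfl hPs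
            exact wle_trans cs (hgx' x hx hsx)
              (hgx g' hg' (wle_trans cs hs₀d (hgx' d hd hsd)))
      · refine ⟨v, hv, fun x hx hvx => ?_⟩
        by_cases hxv : v = x
        · subst hxv; exact wle_refl cs _
        · obtain ⟨s, hs, hsx⟩ := exists_cover cs hvx hxv
          exact absurd ⟨s, hs, hpre _ _ hsx hx⟩ hex
  obtain ⟨g, hg, h⟩ := key _ 1 rfl h1
  exact ⟨g, hg, fun x hx => h x hx (one_wle cs x)⟩

theorem simple_wle_altList [Finite W] {s t : B} (hst : s ≠ t) :
    wle cs (cs.simple s) (cs.wordProd (altList s t (M s t))) := by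
  have hm := coxeterMatrix_ne_zero_of_finite cs hst
  obtain ⟨k, hk⟩ := Nat.exists_eq_succ_of_ne_zero hm
  have hsym := M.symmetric s t
  rw [wle, length_wordProd_altList cs hst (by omega), hk, Nat.succ_eq_add_one, altList,
    cs.wordProd_cons, cs.length_simple, inv_mul_cancel_left,
    length_wordProd_altList cs hst.symm (by omega), add_comm]

/-- Joins exist in the weak order of a finite Coxeter group, and they stay in every down-set `Q`
containing both elements and closed under diamonds. -/
theorem exists_join_mem [Finite W] (Q : W → Prop) (hpre : ∀ u v, wle cs u v → Q v → Q u)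
    (hdia : ∀ v s t, s ≠ t → Q (v * cs.simple s) → Q (v * cs.simple t) →
      cs.length (v * cs.simple s) = cs.length v + 1 →
      cs.length (v * cs.simple t) = cs.length v + 1 →
      cs.length (v * cs.wordProd (altList s t (M s t))) =
        cs.length v + cs.length (cs.wordProd (altList s t (M s t))) →
      Q (v * cs.wordProd (altList s t (M s t)))) (a b : W) (ha : Q a) (hb : Q b) :
    ∃ j, Q j ∧ wle cs a j ∧ wle cs b j ∧ ∀ c, wle cs a c → wle cs b c → wle cs j c := by
  obtain ⟨w₀, hw₀⟩ := exists_longest cs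
  obtain ⟨g, ⟨hg, hgQ⟩, hgx⟩ := exists_greatest_of_diamond cs
    (fun v => (∀ c, wle cs a c → wle cs b c → wle cs v c) ∧ Q v)
    ⟨fun c _ _ => one_wle cs c, hpre _ _ (one_wle cs a) ha⟩
    (fun u v huv hv => ⟨fun c h1 h2 => wle_trans cs huv (hv.1 c h1 h2), hpre _ _ huv hv.2⟩)
    (by
      rintro v s t hst hs ht ⟨hPs, hQs⟩ ⟨hPt, hQt⟩
      have hm := coxeterMatrix_ne_zero_of_finite cs hst
      have hcov : ∀ s, cs.length (v * cs.simple s) = cs.length v + 1 →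
          wle cs v (v * cs.simple s) := fun s hs => by
        rw [wle_mul_iff, cs.length_simple, hs]
      have hc : ∀ c, wle cs (v * cs.simple s) c → wle cs (v * cs.simple t) c →
          wle cs (cs.wordProd (altList s t (M s t))) (v⁻¹ * c) := by
        intro c h1 h2
        have h1' := inv_mul_wle cs (hcov s hs) h1
        have h2' := inv_mul_wle cs (hcov t ht) h2
        rw [inv_mul_cancel_left] at h1' h2'
        exact altList_wle cs hst hm h1' h2'
      have hvc : ∀ c, wle cs v c →
          cs.length (v * (v⁻¹ * c)) = cs.length v + cs.length (v⁻¹ * c) := by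
        intro c h
        rw [mul_inv_cancel_left]; exact h
      have hvw := hvc w₀ (hw₀ v)
      have hadd := length_mul_of_wle cs (hc w₀ (hw₀ _) (hw₀ _)) hvw
      refine ⟨v * cs.wordProd (altList s t (M s t)), ⟨fun c h1 h2 => ?_,
        hdia v s t hst hQs hQt hs ht hadd⟩, ?_, ?_⟩
      · have h3 := hc c (hPs c h1 h2) (hPt c h1 h2)
        have h4 := hvc c (wle_trans cs (hcov s hs) (hPs c h1 h2))
        have := (mul_wle_mul_iff cs (length_mul_of_wle cs h3 h4) h4).mpr h3
        rwa [mul_inv_cancel_left] at this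
      · rw [mul_wle_mul_iff cs (by rw [hs, cs.length_simple]) hadd]
        exact simple_wle_altList cs hst
      · rw [mul_wle_mul_iff cs (by rw [ht, cs.length_simple]) hadd, wordProd_altList_comm]
        have := simple_wle_altList cs hst.symm
        rwa [M.symmetric t s] at this)
  exact ⟨g, hgQ, hgx a ⟨fun c h _ => h, ha⟩, hgx b ⟨fun c _ h => h, hb⟩, hg⟩

end WeakOrder

section Positive

/-- The defining braid relations of the Artin monoid. -/
def posRels (M : CoxeterMatrix B) : FreeMonoid B → FreeMonoid B → Prop := fun a b =>
  ∃ s t : B, s ≠ t ∧ M s t ≠ 0 ∧ a = FreeMonoid.ofList (altList s t (M s t)) ∧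
    b = FreeMonoid.ofList (altList t s (M s t))

/-- The Artin monoid, presented by the braid relations. -/
def Pos (M : CoxeterMatrix B) : Type _ := PresentedMonoid (posRels M)

instance (M : CoxeterMatrix B) : Monoid (Pos M) :=
  inferInstanceAs (Monoid (PresentedMonoid (posRels M)))

variable (M : CoxeterMatrix B)

/-- The generators of the Artin monoid. -/
def pgen (s : B) : Pos M := PresentedMonoid.of (posRels M) s

/-- The element of the Artin monoid represented by a word. -/
def pword (l : List B) : Pos M := (l.map (pgen M)).prod

@[simp] theorem pword_nil : pword M [] = 1 := rfl

@[simp] theorem pword_cons (s : B) (l : List B) : pword M (s :: l) = pgen M s * pword M l := by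
  simp [pword]

@[simp] theorem pword_append (l l' : List B) : pword M (l ++ l') = pword M l * pword M l' := by
  simp [pword]

theorem mk_ofList (l : List B) :
    PresentedMonoid.mk (posRels M) (FreeMonoid.ofList l) = pword M l := by
  induction l with
  | nil => rfl
  | cons s l ih =>
    rw [FreeMonoid.ofList_cons, map_mul, ih, pword_cons]
    rfl

theorem pword_altList_comm {s t : B} (hst : s ≠ t) (hm : M s t ≠ 0) :
    pword M (altList s t (M s t)) = pword M (altList t s (M s t)) := by
  rw [← mk_ofList, ← mk_ofList]
  exact PresentedMonoid.mk_eq_mk_of_rel ⟨s, t, hst, hm, rfl, rfl⟩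

theorem exists_pword (m : Pos M) : ∃ l, pword M l = m := by
  obtain ⟨l, hl⟩ := PresentedMonoid.surjective_mk (rels := posRels M) m
  exact ⟨FreeMonoid.toList l, by rw [← hl, ← mk_ofList]; rfl⟩

variable {M} in
theorem pos_induction {P : Pos M → Prop} (h1 : P 1) (hmul : ∀ s m, P m → P (pgen M s * m))
    (m : Pos M) : P m := by
  obtain ⟨l, rfl⟩ := exists_pword M m
  induction l with
  | nil => exact h1
  | cons s l ih => rw [pword_cons]; exact hmul _ _ ih

/-- The universal property of the Artin monoid. -/
def posLift {N : Type*} [Monoid N] (f : B → N)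
    (h : ∀ s t, s ≠ t → M s t ≠ 0 →
      ((altList s t (M s t)).map f).prod = ((altList t s (M s t)).map f).prod) : Pos M →* N :=
  PresentedMonoid.lift f (by
    rintro a b ⟨s, t, hst, hm, rfl, rfl⟩
    rw [FreeMonoid.lift_ofList, FreeMonoid.lift_ofList]
    exact h s t hst hm)

@[simp] theorem posLift_pgen {N : Type*} [Monoid N] (f : B → N) (h) (s : B) :
    posLift M f h (pgen M s) = f s := rfl

theorem posLift_pword {N : Type*} [Monoid N] (f : B → N) (h) (l : List B) :
    posLift M f h (pword M l) = (l.map f).prod := by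
  rw [pword, map_list_prod, List.map_map]
  rfl

/-- The length homomorphism. -/
def plenHom : Pos M →* Multiplicative ℕ :=
  posLift M (fun _ => Multiplicative.ofAdd 1) (fun s t _ _ => by
    simp [List.map_const', length_altList])

variable {M} in
/-- The length of an element of the Artin monoid. -/
def plen (m : Pos M) : ℕ := (plenHom M m).toAdd

@[simp] theorem plen_one : plen (1 : Pos M) = 0 := by simp [plen]

variable {M} in
@[simp] theorem plen_mul (a b : Pos M) : plen (a * b) = plen a + plen b := by simp [plen]

@[simp] theorem plen_pgen (s : B) : plen (pgen M s) = 1 := rfl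

theorem plen_pword (l : List B) : plen (pword M l) = l.length := by
  induction l with
  | nil => simp
  | cons s l ih => simp [ih, add_comm]

variable {M} in
theorem eq_one_of_plen_eq_zero {m : Pos M} (h : plen m = 0) : m = 1 := by
  obtain ⟨l, rfl⟩ := exists_pword M m
  rw [plen_pword, List.length_eq_zero_iff] at h
  rw [h, pword_nil]

variable {M} in
theorem exists_eq_pgen_mul {m : Pos M} (h : m ≠ 1) : ∃ s m', m = pgen M s * m' := by
  obtain ⟨l, rfl⟩ := exists_pword M m
  rcases l with _ | ⟨s, l⟩
  · exact absurd rfl h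
  · exact ⟨s, pword M l, pword_cons M s l⟩

open Classical in
/-- The homomorphism detecting the elements written with letters in `Z`. -/
noncomputable def suppHom (Z : Set B) : Pos M →* ℕ :=
  posLift M (fun s => if s ∈ Z then 1 else 0) (fun s t hst hm => by
    obtain ⟨k, hk⟩ : ∃ k, M s t = k + 2 := by
      have := M.off_diagonal s t hst
      exact ⟨M s t - 2, by omega⟩
    rw [hk]
    have h1 : ∀ (s t : B) (k : ℕ), s ∈ Z → t ∈ Z →
        ((altList s t k).map (fun s => if s ∈ Z then 1 else 0)).prod = 1 := by
      intro s t k hs ht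
      induction k generalizing s t with
      | zero => rfl
      | succ k ih => simp [altList, hs, ih t s ht hs]
    by_cases hs : s ∈ Z
    · by_cases ht : t ∈ Z
      · rw [h1 s t _ hs ht, h1 t s _ ht hs]
      · simp [altList, ht]
    · simp [altList, hs])

variable {M} in
/-- `m` can be written with letters in `Z` only. -/
def Supp (Z : Set B) (m : Pos M) : Prop := suppHom M Z m = 1

@[simp] theorem supp_one (Z : Set B) : Supp Z (1 : Pos M) := map_one _

variable {M} in
@[simp] theorem supp_mul (Z : Set B) (a b : Pos M) : Supp Z (a * b) ↔ Supp Z a ∧ Supp Z b := by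
  simp [Supp]

@[simp] theorem supp_pgen (Z : Set B) (s : B) : Supp Z (pgen M s) ↔ s ∈ Z := by
  simp [Supp, suppHom]

@[simp] theorem supp_pword (Z : Set B) (l : List B) : Supp Z (pword M l) ↔ ∀ s ∈ l, s ∈ Z := by
  induction l with
  | nil => simp
  | cons s l ih => simp [ih]

theorem supp_univ (m : Pos M) : Supp Set.univ m := by
  obtain ⟨l, rfl⟩ := exists_pword M m
  simp

theorem mem_altList {s t x : B} {k : ℕ} (h : x ∈ altList s t k) : x = s ∨ x = t := by
  induction k generalizing s t with
  | zero => simp [altList] at h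
  | succ k ih =>
    rw [altList, List.mem_cons] at h
    rcases h with h | h
    · exact Or.inl h
    · exact (ih h).symm

theorem reverse_altList (s t : B) (k : ℕ) :
    (altList s t k).reverse = if Even k then altList t s k else altList s t k := by
  suffices h : CoxeterSystem.alternatingWord t s k =
      if Even k then altList t s k else altList s t k by
    rw [← h, altList_eq_reverse_alternatingWord, List.reverse_reverse]
  induction k with
  | zero => simp [altList, CoxeterSystem.alternatingWord]
  | succ k ih =>
    rw [CoxeterSystem.alternatingWord_succ', ih]
    rcases Nat.even_or_odd k with h | h
    · have h' : ¬ Even (k + 1) := by simpa [Nat.even_add_one] using h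
      simp [h, h', altList]
    · have h2 : ¬ Even k := by simpa using h
      have h' : Even (k + 1) := h.add_one
      simp [h2, h', altList]

/-- The reversing anti-automorphism, as a homomorphism to the opposite monoid. -/
def revHom : Pos M →* (Pos M)ᵐᵒᵖ :=
  posLift M (fun s => MulOpposite.op (pgen M s)) (fun s t hst hm => by
    have h : ∀ l : List B, (l.map (fun s => MulOpposite.op (pgen M s))).prod =
        MulOpposite.op (pword M l.reverse) := by
      intro l
      induction l with
      | nil => rfl
      | cons s l ih => simp [ih]
    rw [h, h, reverse_altList, reverse_altList]
    congr 1
    split_ifs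
    · exact (pword_altList_comm M hst hm).symm
    · exact pword_altList_comm M hst hm)

variable {M} in
/-- The reversing anti-automorphism of the Artin monoid. -/
def prev (m : Pos M) : Pos M := (revHom M m).unop

@[simp] theorem prev_one : prev (1 : Pos M) = 1 := by simp [prev]

variable {M} in
@[simp] theorem prev_mul (a b : Pos M) : prev (a * b) = prev b * prev a := by simp [prev]

@[simp] theorem prev_pgen (s : B) : prev (pgen M s) = pgen M s := rfl

variable {M} in
@[simp] theorem prev_prev (m : Pos M) : prev (prev m) = m := by
  induction m using pos_induction with
  | h1 => simp
  | hmul s m ih => simp [ih]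

variable {M} in
theorem plen_prev (m : Pos M) : plen (prev m) = plen m := by
  induction m using pos_induction with
  | h1 => simp
  | hmul s m ih => simp [ih, add_comm]

variable {M} in
theorem exists_eq_mul_pgen {m : Pos M} (h : m ≠ 1) : ∃ s m', m = m' * pgen M s := by
  obtain ⟨s, m', hm⟩ := exists_eq_pgen_mul (m := prev m) (by
    intro h'; apply h; rw [← prev_prev m, h', prev_one])
  exact ⟨s, prev m', by rw [← prev_prev m, hm]; simp⟩

end Positive

section Garside

variable {W : Type*} [Group W] {M : CoxeterMatrix B} (cs : CoxeterSystem M W)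

/-- The projection of the Artin monoid to the Coxeter group. -/
def pproj : Pos M →* W := posLift M cs.simple (fun s t _ _ => wordProd_altList_comm cs s t)

theorem pproj_pword (l : List B) : pproj cs (pword M l) = cs.wordProd l :=
  posLift_pword M _ _ l

/-- Matsumoto's theorem. -/
theorem pword_eq_of_isReduced [Finite W] {l l' : List B} (hl : cs.IsReduced l)
    (hl' : cs.IsReduced l') (h : cs.wordProd l = cs.wordProd l') : pword M l = pword M l' := by
  induction hn : l.length generalizing l l' with
  | zero =>
    have h1 : l'.length = 0 := by rw [← hl'.eq, ← h, hl.eq, hn]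
    rw [List.length_eq_zero_iff] at hn h1
    rw [hn, h1]
  | succ n ih =>
    have hn' : l'.length = n + 1 := by rw [← hl'.eq, ← h, hl.eq, hn]
    rcases l with _ | ⟨s, l⟩
    · simp at hn
    rcases l' with _ | ⟨t, l'⟩
    · simp at hn'
    have hl1 : cs.IsReduced l := hl.drop 1
    have hl1' : cs.IsReduced l' := hl'.drop 1
    simp only [List.length_cons, Nat.add_right_cancel_iff] at hn hn'
    have hw := hl.eq
    have hw' := hl'.eq
    rw [cs.wordProd_cons, List.length_cons] at hw hw'
    by_cases hst : s = t
    · subst hst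
      rw [cs.wordProd_cons, cs.wordProd_cons, mul_right_inj] at h
      rw [pword_cons, pword_cons, ih hl1 hl1' h hn]
    · have hm := coxeterMatrix_ne_zero_of_finite cs hst
      have hs : wle cs (cs.simple s) (cs.wordProd (s :: l)) := by
        rw [cs.wordProd_cons, wle_mul_iff, hw, cs.length_simple, hl1.eq, add_comm]
      have ht : wle cs (cs.simple t) (cs.wordProd (s :: l)) := by
        rw [h, cs.wordProd_cons, wle_mul_iff, hw', cs.length_simple, hl1'.eq, add_comm]
      have hle := altList_wle cs hst hm hs ht
      obtain ⟨l3, hl3, hl3e⟩ := cs.exists_isReduced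
        ((cs.wordProd (altList s t (M s t)))⁻¹ * cs.wordProd (s :: l))
      obtain ⟨k, hk⟩ := Nat.exists_eq_succ_of_ne_zero hm
      rw [wle, hl3e, length_wordProd_altList cs hst (Or.inr le_rfl), hl3.eq, hk, hl.eq,
        List.length_cons, hn] at hle
      rw [inv_mul_eq_iff_eq_mul] at hl3e
      have hb := wordProd_altList_comm cs s t
      have hsym := M.symmetric s t
      have key : ∀ (a b : B) (l0 : List B), cs.wordProd (altList a b (M s t)) =
          cs.wordProd (altList s t (M s t)) → cs.wordProd (a :: l0) = cs.wordProd (s :: l) →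
          cs.IsReduced l0 → l0.length = n →
          pword M (a :: l0) = pword M (altList a b (M s t)) * pword M l3 := by
        intro a b l0 hab h0 hr hlen
        rw [← hab] at hl3e
        rw [hk, Nat.succ_eq_add_one, altList] at hl3e ⊢
        rw [← h0, ← cs.wordProd_append, List.cons_append, cs.wordProd_cons, cs.wordProd_cons,
          mul_right_inj] at hl3e
        rw [pword_cons, pword_cons, mul_assoc, ← pword_append,
          ih hr (l' := altList b a k ++ l3) _ hl3e hlen]
        rw [CoxeterSystem.IsReduced, ← hl3e, hr.eq, List.length_append, length_altList]
        omega
      rw [key s t l rfl rfl hl1 hn, key t s l' hb.symm h.symm hl1' hn',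
        pword_altList_comm M hst hm]

/-- The canonical section of the projection to the Coxeter group. -/
noncomputable def lft (w : W) : Pos M := pword M (cs.exists_isReduced w).choose

theorem lft_wordProd [Finite W] {l : List B} (hl : cs.IsReduced l) :
    lft cs (cs.wordProd l) = pword M l :=
  pword_eq_of_isReduced cs (cs.exists_isReduced (cs.wordProd l)).choose_spec.1 hl
    (cs.exists_isReduced (cs.wordProd l)).choose_spec.2.symm

theorem lft_mul [Finite W] {u v : W} (h : cs.length (u * v) = cs.length u + cs.length v) :
    lft cs (u * v) = lft cs u * lft cs v := by
  obtain ⟨l, hl, rfl⟩ := cs.exists_isReduced u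
  obtain ⟨l', hl', rfl⟩ := cs.exists_isReduced v
  rw [← cs.wordProd_append] at h ⊢
  rw [lft_wordProd cs hl, lft_wordProd cs hl', lft_wordProd, pword_append]
  rw [CoxeterSystem.IsReduced, h, hl.eq, hl'.eq, List.length_append]

theorem lft_one [Finite W] : lft cs 1 = 1 := by
  have := lft_wordProd cs (l := []) (by simp [CoxeterSystem.IsReduced])
  simpa using this

theorem lft_simple [Finite W] (s : B) : lft cs (cs.simple s) = pgen M s := by
  have := lft_wordProd cs (l := [s]) (by simp [CoxeterSystem.IsReduced])
  simpa using this

theorem pproj_lft (w : W) : pproj cs (lft cs w) = w := by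
  rw [lft, pproj_pword]
  exact (cs.exists_isReduced w).choose_spec.2.symm

theorem plen_lft (w : W) : plen (lft cs w) = cs.length w := by
  rw [lft, plen_pword]
  conv_rhs => rw [(cs.exists_isReduced w).choose_spec.2]
  exact (cs.exists_isReduced w).choose_spec.1.eq.symm

theorem length_pproj_le (m : Pos M) : cs.length (pproj cs m) ≤ plen m := by
  obtain ⟨l, rfl⟩ := exists_pword M m
  rw [pproj_pword, plen_pword]
  exact cs.length_wordProd_le l

theorem lft_of_wle [Finite W] {u w : W} (h : wle cs u w) :
    lft cs w = lft cs u * lft cs (u⁻¹ * w) := by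
  have := lft_mul cs (u := u) (v := u⁻¹ * w) (by rw [mul_inv_cancel_left]; exact h)
  rwa [mul_inv_cancel_left] at this

variable [Finite W]

theorem exists_join (a b : W) :
    ∃ j, wle cs a j ∧ wle cs b j ∧ ∀ c, wle cs a c → wle cs b c → wle cs j c := by
  obtain ⟨j, -, h⟩ := exists_join_mem cs (fun _ => True) (fun _ _ _ _ => trivial)
    (fun _ _ _ _ _ _ _ _ _ => trivial) a b trivial trivial
  exact ⟨j, h⟩

/-- The join in the weak order. -/
noncomputable def join (a b : W) : W := (exists_join cs a b).choose

theorem wle_join_left (a b : W) : wle cs a (join cs a b) := (exists_join cs a b).choose_spec.1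

theorem wle_join_right (a b : W) : wle cs b (join cs a b) := (exists_join cs a b).choose_spec.2.1

theorem join_wle {a b c : W} (h1 : wle cs a c) (h2 : wle cs b c) : wle cs (join cs a b) c :=
  (exists_join cs a b).choose_spec.2.2 c h1 h2

theorem join_comm (a b : W) : join cs a b = join cs b a :=
  wle_antisymm cs (join_wle cs (wle_join_right cs b a) (wle_join_left cs b a))
    (join_wle cs (wle_join_right cs a b) (wle_join_left cs a b))

theorem join_eq_left {a b : W} (h : wle cs b a) : join cs a b = a :=
  wle_antisymm cs (join_wle cs (wle_refl cs a) h) (wle_join_left cs a b)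

theorem supp_lft_join {Z : Set B} {a b : W} (ha : Supp Z (lft cs a)) (hb : Supp Z (lft cs b)) :
    Supp Z (lft cs (join cs a b)) := by
  obtain ⟨j, hj, h1, h2, h3⟩ := exists_join_mem cs (fun w => Supp Z (lft cs w))
    (fun u v huv hv => by
      simp only [lft_of_wle cs huv, supp_mul] at hv
      exact hv.1)
    (fun v s t hst hs ht h1 h2 h3 => by
      have hm := coxeterMatrix_ne_zero_of_finite cs hst
      simp only [lft_mul cs (u := v) (v := cs.simple s) (by rw [h1, cs.length_simple]),
        lft_mul cs (u := v) (v := cs.simple t) (by rw [h2, cs.length_simple]),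
        lft_simple, supp_mul, supp_pgen] at hs ht
      simp only [lft_mul cs h3, supp_mul]
      refine ⟨hs.1, ?_⟩
      rw [lft_wordProd cs (by rw [CoxeterSystem.IsReduced, length_wordProd_altList cs hst
        (Or.inr le_rfl), length_altList]), supp_pword]
      intro x hx
      rcases mem_altList hx with rfl | rfl
      · exact hs.2
      · exact ht.2) a b ha hb
  rwa [wle_antisymm cs (join_wle cs h1 h2) (h3 _ (wle_join_left cs a b) (wle_join_right cs a b))]

/-- The residue `u⁻¹ (u ∨ w)`. -/
noncomputable def resid (u w : W) : W := u⁻¹ * join cs u w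

theorem lft_mul_lft_resid (u w : W) : lft cs u * lft cs (resid cs u w) = lft cs (join cs u w) :=
  (lft_of_wle cs (wle_join_left cs u w)).symm

theorem resid_self (u : W) : resid cs u u = 1 := by
  rw [resid, join_eq_left cs (wle_refl cs u), inv_mul_cancel]

theorem resid_one (u : W) : resid cs u 1 = 1 := by
  rw [resid, join_eq_left cs (one_wle cs u), inv_mul_cancel]

theorem one_resid (u : W) : resid cs 1 u = u := by
  rw [resid, join_comm, join_eq_left cs (one_wle cs u), inv_one, one_mul]

theorem length_mul_resid (u w : W) :
    cs.length (u * resid cs u w) = cs.length u + cs.length (resid cs u w) := by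
  rw [resid, mul_inv_cancel_left]; exact wle_join_left cs u w

theorem mul_join {u a b : W} (ha : cs.length (u * a) = cs.length u + cs.length a)
    (hb : cs.length (u * b) = cs.length u + cs.length b) :
    u * join cs a b = join cs (u * a) (u * b) := by
  obtain ⟨c, hc⟩ : ∃ c, join cs (u * a) (u * b) = u * c := ⟨u⁻¹ * _, (mul_inv_cancel_left _ _).symm⟩
  have h1 := wle_join_left cs (u * a) (u * b)
  have h2 := wle_join_right cs (u * a) (u * b)
  rw [hc] at h1 h2
  have h3 : cs.length (u * c) = cs.length u + cs.length c :=
    (wle_mul_iff cs u c).mp (wle_trans cs ((wle_mul_iff cs u a).mpr ha) h1)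
  rw [mul_wle_mul_iff cs ha h3] at h1
  rw [mul_wle_mul_iff cs hb h3] at h2
  have h4 := join_wle cs h1 h2
  have h5 := length_mul_of_wle cs h4 h3
  apply wle_antisymm cs
  · rw [hc, mul_wle_mul_iff cs h5 h3]
    exact h4
  · exact join_wle cs ((mul_wle_mul_iff cs ha h5).mpr (wle_join_left cs a b))
      ((mul_wle_mul_iff cs hb h5).mpr (wle_join_right cs a b))

theorem mul_join_resid {u v w : W} (h : cs.length (u * v) = cs.length u + cs.length v) :
    u * join cs v (resid cs u w) = join cs (u * v) w := by
  rw [mul_join cs h (length_mul_resid cs u w), resid, mul_inv_cancel_left]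
  have h1 : wle cs u (u * v) := (wle_mul_iff cs u v).mpr h
  exact wle_antisymm cs
    (join_wle cs (wle_join_left cs _ _)
      (join_wle cs (wle_trans cs h1 (wle_join_left cs _ _)) (wle_join_right cs _ _)))
    (join_wle cs (wle_join_left cs _ _)
      (wle_trans cs (wle_join_right cs u w) (wle_join_right cs _ _)))

theorem mul_resid {u v w : W} (h : cs.length (u * v) = cs.length u + cs.length v) :
    resid cs (u * v) w = resid cs v (resid cs u w) := by
  rw [resid, ← mul_join_resid cs h, mul_inv_rev, mul_assoc, inv_mul_cancel_left]
  rfl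

theorem lft_resid_mul {u v w : W} (h : cs.length (u * v) = cs.length u + cs.length v) :
    lft cs (resid cs w (u * v)) = lft cs (resid cs w u) * lft cs (resid cs (resid cs u w) v) := by
  have h1 : resid cs w (u * v) = resid cs w u * resid cs (resid cs u w) v := by
    have := mul_join_resid cs (w := w) h
    rw [resid, join_comm, ← this, join_comm cs v]
    change _ = w⁻¹ * join cs w u * ((u⁻¹ * join cs u w)⁻¹ * join cs (resid cs u w) v)
    rw [join_comm cs w u]
    group
  rw [h1, lft_mul]
  rw [← h1]
  have h2 : wle cs (join cs w u) (join cs w (u * v)) :=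
    join_wle cs (wle_join_left cs _ _)
      (wle_trans cs ((wle_mul_iff cs u v).mpr h) (wle_join_right cs _ _))
  have h3 := inv_mul_wle cs (wle_join_left cs w u) h2
  change wle cs (resid cs w u) (resid cs w (u * v)) at h3
  rw [h1, wle_mul_iff] at h3
  rw [h1, h3]

end Garside

section Action

/-- The wreath-type monoid of maps `W → W × N`. -/
def Wreath (W N : Type*) := W → W × N

instance (W N : Type*) [Monoid N] : Monoid (Wreath W N) where
  mul F G := fun w => ((G (F w).1).1, (F w).2 * (G (F w).1).2)
  one := fun w => (w, 1)
  mul_assoc F G H := funext fun w => Prod.ext rfl (mul_assoc _ _ _)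
  one_mul F := funext fun w => Prod.ext rfl (one_mul _)
  mul_one F := funext fun w => Prod.ext rfl (mul_one _)

theorem wreath_ext {W N : Type*} {F G : Wreath W N} (h : ∀ w, F w = G w) : F = G := funext h

theorem wreath_mul_apply {W N : Type*} [Monoid N] (F G : Wreath W N) (w : W) :
    (F * G) w = ((G (F w).1).1, (F w).2 * (G (F w).1).2) := rfl

theorem wreath_one_apply {W N : Type*} [Monoid N] (w : W) :
    (1 : Wreath W N) w = (w, 1) := rfl

variable {W : Type*} [Group W] {M : CoxeterMatrix B} (cs : CoxeterSystem M W) [Finite W]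

/-- The action of a generator on pairs (residue, complement). -/
noncomputable def wreathGen (s : B) : Wreath W (Pos M) :=
  fun w => (resid cs (cs.simple s) w, lft cs (resid cs w (cs.simple s)))

theorem prod_wreathGen {l : List B} (hl : cs.IsReduced l) (w : W) :
    (l.map (wreathGen cs)).prod w =
      (resid cs (cs.wordProd l) w, lft cs (resid cs w (cs.wordProd l))) := by
  induction l generalizing w with
  | nil =>
    simp [wreath_one_apply, one_resid, resid_one, lft_one]
  | cons s l ih =>
    have hl1 : cs.IsReduced l := hl.drop 1
    have h : cs.length (cs.simple s * cs.wordProd l) =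
        cs.length (cs.simple s) + cs.length (cs.wordProd l) := by
      rw [← cs.wordProd_cons, hl.eq, hl1.eq, cs.length_simple, List.length_cons, add_comm]
    rw [List.map_cons, List.prod_cons, wreath_mul_apply, ih hl1, cs.wordProd_cons,
      mul_resid cs h, lft_resid_mul cs h]
    rfl

omit [Finite W] in
theorem isReduced_altList {s t : B} (hst : s ≠ t) {k : ℕ} (hk : k ≤ M s t) :
    cs.IsReduced (altList s t k) := by
  rw [CoxeterSystem.IsReduced, length_wordProd_altList cs hst (Or.inr hk), length_altList]

/-- The homomorphism giving the action of the Artin monoid on residues. -/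
noncomputable def wreathHom : Pos M →* Wreath W (Pos M) :=
  posLift M (wreathGen cs) (fun s t hst _ => by
    refine wreath_ext fun w => ?_
    have hsym := M.symmetric s t
    rw [prod_wreathGen cs (isReduced_altList cs hst le_rfl),
      prod_wreathGen cs (isReduced_altList cs hst.symm hsym.le), wordProd_altList_comm])

/-- The residue of `w` by `m`. -/
noncomputable def act (m : Pos M) (w : W) : W := (wreathHom cs m w).1

/-- The complement of `m` by `w`. -/
noncomputable def cpl (w : W) (m : Pos M) : Pos M := (wreathHom cs m w).2

@[simp] theorem act_one_left (w : W) : act cs 1 w = w := by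
  rw [act, map_one, wreath_one_apply]

@[simp] theorem cpl_one_right (w : W) : cpl cs w 1 = 1 := by
  rw [cpl, map_one, wreath_one_apply]

theorem act_mul (m n : Pos M) (w : W) : act cs (m * n) w = act cs n (act cs m w) := by
  rw [act, map_mul, wreath_mul_apply]; rfl

theorem cpl_mul (m n : Pos M) (w : W) :
    cpl cs w (m * n) = cpl cs w m * cpl cs (act cs m w) n := by
  rw [cpl, map_mul, wreath_mul_apply]; rfl

theorem wreathHom_lft (u w : W) :
    wreathHom cs (lft cs u) w = (resid cs u w, lft cs (resid cs w u)) := by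
  obtain ⟨l, hl, rfl⟩ := cs.exists_isReduced u
  rw [lft_wordProd cs hl, wreathHom, posLift_pword, prod_wreathGen cs hl]

theorem act_lft (u w : W) : act cs (lft cs u) w = resid cs u w := by
  rw [act, wreathHom_lft]

theorem cpl_lft (u w : W) : cpl cs w (lft cs u) = lft cs (resid cs w u) := by
  rw [cpl, wreathHom_lft]

theorem act_pgen (s : B) (w : W) : act cs (pgen M s) w = resid cs (cs.simple s) w := by
  rw [← lft_simple cs, act_lft]

theorem cpl_pgen (s : B) (w : W) : cpl cs w (pgen M s) = lft cs (resid cs w (cs.simple s)) := by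
  rw [← lft_simple cs, cpl_lft]

theorem act_one_right (m : Pos M) : act cs m 1 = 1 := by
  induction m using pos_induction with
  | h1 => simp
  | hmul s m ih => rw [act_mul, act_pgen, resid_one, ih]

theorem cpl_one_left (m : Pos M) : cpl cs 1 m = m := by
  induction m using pos_induction with
  | h1 => simp
  | hmul s m ih => rw [cpl_mul, act_pgen, resid_one, ih, cpl_pgen, one_resid, lft_simple]

theorem cpl_lft_mul (w : W) (m : Pos M) : cpl cs w (lft cs w * m) = m := by
  rw [cpl_mul, cpl_lft, act_lft, resid_self, cpl_one_left, lft_one, one_mul]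

theorem lft_mul_cpl (w : W) (m : Pos M) :
    lft cs w * cpl cs w m = m * lft cs (act cs m w) := by
  induction m using pos_induction generalizing w with
  | h1 => simp
  | hmul s m ih =>
    rw [cpl_mul, act_mul, mul_assoc, ← ih, cpl_pgen, ← mul_assoc, ← mul_assoc, lft_mul_lft_resid,
      act_pgen, ← lft_simple cs s, lft_mul_lft_resid, join_comm]

theorem lft_dvd_iff {v : W} {y : Pos M} : lft cs v ∣ y ↔ act cs y v = 1 := by
  constructor
  · rintro ⟨c, rfl⟩
    rw [act_mul, act_lft, resid_self, act_one_right]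
  · intro h
    have := lft_mul_cpl cs v y
    rw [h, lft_one, mul_one] at this
    exact ⟨_, this.symm⟩

theorem lft_dvd_mul_iff {w : W} {m y : Pos M} :
    lft cs w ∣ m * y ↔ lft cs (act cs m w) ∣ y := by
  rw [lft_dvd_iff, lft_dvd_iff, act_mul]

theorem lft_join_dvd {u v : W} {m : Pos M} (hu : lft cs u ∣ m) (hv : lft cs v ∣ m) :
    lft cs (join cs u v) ∣ m := by
  obtain ⟨c, rfl⟩ := hu
  rw [lft_dvd_mul_iff, act_lft] at hv
  rw [← lft_mul_lft_resid]
  exact mul_dvd_mul_left _ hv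

theorem lft_dvd_lft {u v : W} (h : wle cs u v) : lft cs u ∣ lft cs v :=
  ⟨_, lft_of_wle cs h⟩

theorem supp_act_cpl {Z : Set B} {m : Pos M} (hm : Supp Z m) {w : W} (hw : Supp Z (lft cs w)) :
    Supp Z (lft cs (act cs m w)) ∧ Supp Z (cpl cs w m) := by
  induction m using pos_induction generalizing w with
  | h1 => simpa using hw
  | hmul s m ih =>
    rw [supp_mul] at hm
    have h1 : Supp Z (lft cs (cs.simple s)) := by rw [lft_simple]; exact hm.1
    have h2 := supp_lft_join cs h1 hw
    have h3 := supp_lft_join cs hw h1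
    rw [← lft_mul_lft_resid, supp_mul] at h2 h3
    rw [act_mul, cpl_mul, act_pgen, cpl_pgen, supp_mul]
    have := ih hm.2 h2.2
    exact ⟨this.1, h3.2, this.2⟩

include cs in
theorem pos_mul_left_cancel {a b c : Pos M} (h : a * b = a * c) : b = c := by
  induction a using pos_induction with
  | h1 => simpa using h
  | hmul s a ih =>
    apply ih
    rw [mul_assoc, mul_assoc, ← lft_simple cs s] at h
    rw [← cpl_lft_mul cs (cs.simple s) (a * b), h, cpl_lft_mul]

include cs in
theorem pos_mul_right_cancel {a b c : Pos M} (h : b * a = c * a) : b = c := by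
  have := congrArg prev h
  rw [prev_mul, prev_mul] at this
  have := pos_mul_left_cancel cs this
  rw [← prev_prev b, this, prev_prev]

end Action

section GarsideElement

variable {W : Type*} [Group W] {M : CoxeterMatrix B} (cs : CoxeterSystem M W) [Finite W] [Finite B]

theorem exists_garside (Z : Set B) : ∃ w : W, Supp Z (lft cs w) ∧
    ∀ m, lft cs w ∣ m ↔ ∀ s ∈ Z, pgen M s ∣ m := by
  suffices h : ∀ Y : Set B, Y ⊆ Z → ∃ w : W, Supp Z (lft cs w) ∧
      ∀ m, lft cs w ∣ m ↔ ∀ s ∈ Y, pgen M s ∣ m from h Z le_rfl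
  intro Y
  induction Y, Set.toFinite Y using Set.Finite.induction_on with
  | empty => exact fun _ => ⟨1, by simp [lft_one]⟩
  | @insert a Y _ _ ih =>
    intro hY
    obtain ⟨w, hw, h⟩ := ih (fun x hx => hY (Set.mem_insert_of_mem _ hx))
    refine ⟨join cs (cs.simple a) w, supp_lft_join cs ?_ hw, fun m => ?_⟩
    · rw [lft_simple, supp_pgen]
      exact hY (Set.mem_insert _ _)
    · rw [Set.forall_mem_insert, ← h m, ← lft_simple cs a]
      exact ⟨fun hm => ⟨(lft_dvd_lft cs (wle_join_left cs _ _)).trans hm,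
        (lft_dvd_lft cs (wle_join_right cs _ _)).trans hm⟩, fun hm => lft_join_dvd cs hm.1 hm.2⟩

/-- The longest element of the parabolic subgroup `W_Z`. -/
noncomputable def gw (Z : Set B) : W := (exists_garside cs Z).choose

/-- The Garside element of the parabolic submonoid generated by `Z`. -/
noncomputable def dl (Z : Set B) : Pos M := lft cs (gw cs Z)

theorem supp_dl (Z : Set B) : Supp Z (dl cs Z) := (exists_garside cs Z).choose_spec.1

theorem dl_dvd_iff {Z : Set B} {m : Pos M} : dl cs Z ∣ m ↔ ∀ s ∈ Z, pgen M s ∣ m :=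
  (exists_garside cs Z).choose_spec.2 m

theorem pgen_dvd_dl {Z : Set B} {s : B} (hs : s ∈ Z) : pgen M s ∣ dl cs Z :=
  (dl_dvd_iff cs).mp dvd_rfl s hs

omit [Finite B] in
theorem join_simple {s t : B} (hst : s ≠ t) :
    join cs (cs.simple s) (cs.simple t) = cs.wordProd (altList s t (M s t)) := by
  have hsym := M.symmetric s t
  refine wle_antisymm cs (join_wle cs (simple_wle_altList cs hst) ?_) (altList_wle cs hst
    (coxeterMatrix_ne_zero_of_finite cs hst) (wle_join_left cs _ _) (wle_join_right cs _ _))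
  rw [wordProd_altList_comm, hsym]
  exact simple_wle_altList cs hst.symm

omit [Finite B] in
theorem altList_succ_eq_append (s t : B) (k : ℕ) :
    ∃ x, altList s t (k + 1) = altList s t k ++ [x] := by
  induction k generalizing s t with
  | zero => exact ⟨s, rfl⟩
  | succ k ih =>
    obtain ⟨x, hx⟩ := ih t s
    exact ⟨x, by rw [altList, hx]; rfl⟩

theorem dl_dvd_pgen_mul_dl {Z : Set B} {s : B} (hs : s ∈ Z) : dl cs Z ∣ pgen M s * dl cs Z := by
  rw [dl_dvd_iff]
  intro t ht
  by_cases hst : s = t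
  · rw [hst]; exact dvd_mul_right _ _
  rw [← lft_simple cs t, lft_dvd_mul_iff, act_pgen]
  have h1 : lft cs (join cs (cs.simple s) (cs.simple t)) ∣ dl cs Z := by
    apply lft_join_dvd <;> rw [lft_simple]
    exacts [pgen_dvd_dl cs hs, pgen_dvd_dl cs ht]
  refine dvd_trans ?_ h1
  obtain ⟨k, hk⟩ := Nat.exists_eq_succ_of_ne_zero (coxeterMatrix_ne_zero_of_finite cs hst)
  have hsym := M.symmetric s t
  have h2 : resid cs (cs.simple s) (cs.simple t) = cs.wordProd (altList t s k) := by
    rw [resid, join_simple cs hst, hk, Nat.succ_eq_add_one, altList, cs.wordProd_cons,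
      inv_mul_cancel_left]
  obtain ⟨x, hx⟩ := altList_succ_eq_append t s k
  rw [h2, join_simple cs hst, wordProd_altList_comm cs, lft_wordProd cs
    (isReduced_altList cs (Ne.symm hst) (by omega)), lft_wordProd cs
    (isReduced_altList cs (Ne.symm hst) hsym.le), hk, Nat.succ_eq_add_one, hx, pword_append]
  exact dvd_mul_right _ _

theorem exists_pgen_mul_dl {Z : Set B} {s : B} (hs : s ∈ Z) :
    ∃ t ∈ Z, pgen M s * dl cs Z = dl cs Z * pgen M t := by
  obtain ⟨c, hc⟩ := dl_dvd_pgen_mul_dl cs hs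
  have h1 : plen c = 1 := by
    have := congrArg plen hc
    rw [plen_mul, plen_mul, plen_pgen] at this
    omega
  obtain ⟨t, c', rfl⟩ := exists_eq_pgen_mul (m := c) (by rintro rfl; simp at h1)
  rw [plen_mul, plen_pgen] at h1
  have h2 := eq_one_of_plen_eq_zero (m := c') (by omega)
  rw [h2, mul_one] at hc
  refine ⟨t, ?_, hc⟩
  have h3 : Supp Z (dl cs Z * pgen M t) := by
    rw [← hc, supp_mul]
    exact ⟨(supp_pgen M Z s).mpr hs, supp_dl cs Z⟩
  rw [supp_mul] at h3
  exact (supp_pgen M Z t).mp h3.2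

omit [Finite B] in
theorem pgen_injective (M : CoxeterMatrix B) : Function.Injective (pgen M) := by
  intro s t h
  have : Supp {t} (pgen M s) := by rw [h]; simp
  simpa using this

/-- Conjugation by the Garside element permutes the generators. -/
theorem exists_perm (Z : Set B) : ∃ σ : Equiv.Perm Z, ∀ s : Z,
    pgen M s * dl cs Z = dl cs Z * pgen M (σ s) := by
  choose f hf hf' using fun s : Z => exists_pgen_mul_dl cs s.2
  have hinj : Function.Injective (fun s : Z => (⟨f s, hf s⟩ : Z)) := by
    intro s t h
    have h1 : f s = f t := congrArg Subtype.val h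
    have h2 := hf' s
    rw [h1, ← hf' t] at h2
    exact Subtype.ext (pgen_injective M (pos_mul_right_cancel cs h2))
  exact ⟨Equiv.ofBijective _ (Finite.injective_iff_bijective.mp hinj), hf'⟩

theorem exists_dl_pow_commute (Z : Set B) : ∃ k : ℕ, 1 ≤ k ∧ ∀ m, Supp Z m →
    m * dl cs Z ^ k = dl cs Z ^ k * m := by
  obtain ⟨σ, hσ⟩ := exists_perm cs Z
  have h : ∀ (n : ℕ) (s : Z), pgen M s * dl cs Z ^ n = dl cs Z ^ n * pgen M ((σ ^ n) s) := by
    intro n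
    induction n with
    | zero => simp
    | succ n ih =>
      intro s
      rw [pow_succ, ← mul_assoc, ih, mul_assoc, hσ, pow_succ' σ, mul_assoc]
      rfl
  refine ⟨orderOf σ, orderOf_pos σ, fun m hm => ?_⟩
  induction m using pos_induction with
  | h1 => simp
  | hmul s m ih =>
    rw [supp_mul, supp_pgen] at hm
    rw [mul_assoc, ih hm.2, ← mul_assoc, h _ ⟨s, hm.1⟩, pow_orderOf_eq_one, mul_assoc]
    rfl

theorem exists_dl_eq_mul_pgen {Z : Set B} {t : B} (ht : t ∈ Z) :
    ∃ c, dl cs Z = c * pgen M t := by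
  obtain ⟨σ, hσ⟩ := exists_perm cs Z
  obtain ⟨s, hs⟩ := σ.surjective ⟨t, ht⟩
  obtain ⟨c, hc⟩ := pgen_dvd_dl cs s.2
  refine ⟨c, ?_⟩
  have h := hσ s
  rw [hs] at h
  have h2 : pgen M s * dl cs Z = pgen M s * (c * pgen M t) := by
    rw [h]; nth_rewrite 1 [hc]; rw [mul_assoc]
  exact pos_mul_left_cancel cs h2

theorem dl_rdvd_iff {Z : Set B} {m : Pos M} :
    (∃ c, m = c * dl cs Z) ↔ ∀ t ∈ Z, ∃ c, m = c * pgen M t := by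
  constructor
  · rintro ⟨c, rfl⟩ t ht
    obtain ⟨d, hd⟩ := exists_dl_eq_mul_pgen cs ht
    exact ⟨c * d, by rw [mul_assoc, ← hd]⟩
  · intro h
    have h1 : dl cs Z ∣ prev (dl cs Z) := by
      rw [dl_dvd_iff]
      intro s hs
      obtain ⟨c, hc⟩ := exists_dl_eq_mul_pgen cs hs
      exact ⟨prev c, by rw [hc]; simp⟩
    obtain ⟨d, hd⟩ := h1
    have h2 : plen d = 0 := by
      have := congrArg plen hd
      rw [plen_mul, plen_prev] at this
      omega
    rw [eq_one_of_plen_eq_zero h2, mul_one] at hd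
    have h3 : dl cs Z ∣ prev m := by
      rw [dl_dvd_iff]
      intro s hs
      obtain ⟨c, rfl⟩ := h s hs
      exact ⟨prev c, by simp⟩
    obtain ⟨c, hc⟩ := h3
    refine ⟨prev c, ?_⟩
    rw [← prev_prev m, hc, prev_mul, hd]

/-- A power of the Garside element is central in the parabolic submonoid, and every element of
this submonoid divides a power of it. -/
theorem exists_central (Z : Set B) : ∃ k : ℕ, 1 ≤ k ∧
    (∀ m, Supp Z m → m * dl cs Z ^ k = dl cs Z ^ k * m) ∧
    ∀ m, Supp Z m → ∃ (n : ℕ) (c : Pos M),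
      Supp Z c ∧ c * m = (dl cs Z ^ k) ^ n ∧ m * c = (dl cs Z ^ k) ^ n := by
  obtain ⟨k, hk, hz⟩ := exists_dl_pow_commute cs Z
  refine ⟨k, hk, hz, fun m hm => ?_⟩
  suffices h : ∃ (n : ℕ) (c : Pos M), Supp Z c ∧ c * m = (dl cs Z ^ k) ^ n by
    obtain ⟨n, c, hc, h⟩ := h
    refine ⟨n, c, hc, h, ?_⟩
    apply pos_mul_left_cancel cs (a := c)
    have := ((show Commute c _ from hz c hc).pow_right n).eq
    rw [this, ← mul_assoc, h]
  induction m using pos_induction with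
  | h1 => exact ⟨0, 1, by simp⟩
  | hmul s m ih =>
    rw [supp_mul, supp_pgen] at hm
    obtain ⟨n, c, hc, h⟩ := ih hm.2
    obtain ⟨d, hd⟩ := exists_dl_eq_mul_pgen cs hm.1
    obtain ⟨j, rfl⟩ : ∃ j, k = j + 1 := ⟨k - 1, by omega⟩
    have h1 : dl cs Z ^ (j + 1) = dl cs Z ^ j * d * pgen M s := by
      rw [pow_succ, mul_assoc, ← hd]
    have h2 : Supp Z (dl cs Z ^ j * d * pgen M s) := by
      rw [← h1, Supp, map_pow, show suppHom M Z (dl cs Z) = 1 from supp_dl cs Z, one_pow]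
    rw [supp_mul] at h2
    refine ⟨n + 1, c * (dl cs Z ^ j * d), (supp_mul Z _ _).mpr ⟨hc, h2.1⟩, ?_⟩
    calc c * (dl cs Z ^ j * d) * (pgen M s * m)
        = c * (dl cs Z ^ j * d * pgen M s) * m := by simp only [mul_assoc]
      _ = _ := by rw [← h1, hz c hc, mul_assoc, h, pow_succ' _ n]

end GarsideElement

section Embedding

/-- The canonical homomorphism from the Artin monoid to the Artin group. -/
def toArtin (M : CoxeterMatrix B) : Pos M →* Artin M :=
  posLift M (gen M) (fun s t hst hm => by
    have h : ∀ l : List B, (l.map (gen M)).prod =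
        PresentedGroup.mk (braidRels M) ((l.map FreeGroup.of).prod) := by
      intro l
      rw [map_list_prod, List.map_map]
      rfl
    rw [h, h]
    apply PresentedGroup.mk_eq_mk_of_mul_inv_mem
    exact ⟨s, t, hst, hm, rfl⟩)

@[simp] theorem toArtin_pgen (M : CoxeterMatrix B) (s : B) : toArtin M (pgen M s) = gen M s := rfl

/-- A central element generates an Ore set in a right cancellative monoid. -/
@[reducible] def oreSetPowers {R : Type*} [Monoid R] [IsRightCancelMul R] {z : R}
    (hz : ∀ m, m * z = z * m) : OreLocalization.OreSet (Submonoid.powers z) where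
  ore_right_cancel _ _ s h := ⟨1, by rw [mul_right_cancel h]⟩
  oreNum r _ := r
  oreDenom _ s := s
  ore_eq r s := by
    obtain ⟨_, n, rfl⟩ := s
    exact ((show Commute r z from hz r).pow_right n).eq.symm

/-- A cancellative monoid in which every element divides a power of a central element embeds
in a group; here expressed with units of a localization. -/
theorem exists_injective_hom_isUnit.{u} {R : Type u} [Monoid R] [IsRightCancelMul R] {z : R}
    (hz : ∀ m, m * z = z * m) (hdiv : ∀ m, ∃ (n : ℕ) (c : R), c * m = z ^ n ∧ m * c = z ^ n) :
    ∃ (L : Type u) (_ : Monoid L) (f : R →* L), Function.Injective f ∧ ∀ m, IsUnit (f m) := by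
  let _ := oreSetPowers hz
  refine ⟨OreLocalization (Submonoid.powers z) R, inferInstance,
    OreLocalization.numeratorHom, fun a b h => ?_, fun m => ?_⟩
  · rw [OreLocalization.numeratorHom_apply, OreLocalization.numeratorHom_apply,
      OreLocalization.oreDiv_eq_iff] at h
    obtain ⟨u, v, h1, h2⟩ := h
    obtain ⟨_, n, rfl⟩ := u
    simp only [Submonoid.smul_def, OneMemClass.coe_one, mul_one, smul_eq_mul] at h1 h2
    have h3 := ((show Commute a z from hz a).pow_right n).eq
    have h4 := ((show Commute b z from hz b).pow_right n).eq
    rw [← h2] at h1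
    change z ^ n * b = z ^ n * a at h1
    rw [← h3, ← h4] at h1
    exact (mul_right_cancel h1).symm
  · obtain ⟨n, c, h1, h2⟩ := hdiv m
    have hu : IsUnit (OreLocalization.numeratorHom (S := Submonoid.powers z) (z ^ n)) :=
      OreLocalization.numerator_isUnit (S := Submonoid.powers z) ⟨z ^ n, ⟨n, rfl⟩⟩
    obtain ⟨u, hu⟩ := hu
    rw [isUnit_iff_exists_and_exists]
    refine ⟨⟨OreLocalization.numeratorHom (S := Submonoid.powers z) c * ↑u⁻¹, ?_⟩, 
      ⟨↑u⁻¹ * OreLocalization.numeratorHom (S := Submonoid.powers z) c, ?_⟩⟩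
    · rw [← mul_assoc, ← map_mul, h2, ← hu, Units.mul_inv]
    · rw [mul_assoc, ← map_mul, h1, ← hu, Units.inv_mul]

variable {W : Type*} [Group W] {M : CoxeterMatrix B} (cs : CoxeterSystem M W) [Finite W] [Finite B]

include cs in
theorem toArtin_injective : Function.Injective (toArtin M) := by
  have : IsRightCancelMul (Pos M) := ⟨fun _ _ _ h => pos_mul_right_cancel cs h⟩
  obtain ⟨k, _, hz, hdiv⟩ := exists_central cs (Set.univ : Set B)
  obtain ⟨L, _, f, hf, hu⟩ := exists_injective_hom_isUnit
    (fun m => hz m (supp_univ M m)) (fun m => by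
      obtain ⟨n, c, -, h⟩ := hdiv m (supp_univ M m)
      exact ⟨n, c, h⟩)
  let g : B → Lˣ := fun s => (hu (pgen M s)).unit
  have hg : ∀ l : List B, (((l.map g).prod : Lˣ) : L) = f (pword M l) := by
    intro l
    induction l with
    | nil => simp
    | cons s l ih => rw [List.map_cons, List.prod_cons, Units.val_mul, ih, pword_cons, map_mul]; rfl
  let G : Artin M →* Lˣ := PresentedGroup.toGroup (f := g) (rels := braidRels M) (by
    rintro r ⟨s, t, hst, hm, rfl⟩
    have h : ∀ l : List B, FreeGroup.lift g ((l.map FreeGroup.of).prod) = (l.map g).prod := by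
      intro l
      rw [map_list_prod, List.map_map]
      congr 1
      simp [Function.comp_def]
    rw [map_mul, map_inv, h, h, mul_inv_eq_one]
    apply Units.ext
    rw [hg, hg, pword_altList_comm M hst hm])
  have hG : ∀ m, ((G (toArtin M m) : Lˣ) : L) = f m := by
    intro m
    induction m using pos_induction with
    | h1 => simp
    | hmul s m ih =>
      rw [map_mul, map_mul, Units.val_mul, ih, map_mul, toArtin_pgen]
      congr 1
      exact congrArg Units.val (PresentedGroup.toGroup.of _)
  intro a b h
  apply hf
  rw [← hG, ← hG, h]

end Embedding

section Ribbon

variable {W : Type*} [Group W] {M : CoxeterMatrix B} (cs : CoxeterSystem M W) [Finite W] [Finite B]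

omit [Finite B] in
theorem supp_pow {Z : Set B} {m : Pos M} (hm : Supp Z m) (n : ℕ) : Supp Z (m ^ n) := by
  rw [Supp, map_pow, show suppHom M Z m = 1 from hm, one_pow]

theorem dl_squarefree {Z : Set B} (a : Pos M) (s : B) (b : Pos M) :
    dl cs Z ≠ a * pgen M s * pgen M s * b := by
  intro h
  have h1 : plen (dl cs Z) = cs.length (pproj cs (dl cs Z)) := by
    rw [dl, plen_lft, pproj_lft]
  have h2 : pproj cs (dl cs Z) = pproj cs a * pproj cs b := by
    have h3 : pproj cs (pgen M s) = cs.simple s := posLift_pgen M _ _ s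
    rw [h, map_mul, map_mul, map_mul, h3, cs.simple_mul_simple_cancel_right]
  have h4 := cs.length_mul_le (pproj cs a) (pproj cs b)
  have h5 := length_pproj_le cs a
  have h6 := length_pproj_le cs b
  rw [h2, h] at h1
  simp only [plen_mul, plen_pgen] at h1
  omega

omit [Finite B] in
theorem exists_transport {Y Y' : Set B} {d : Pos M}
    (h : ∀ y ∈ Y, ∃ y' ∈ Y', d * pgen M y = pgen M y' * d) {m : Pos M} (hm : Supp Y m) :
    ∃ m', Supp Y' m' ∧ plen m' = plen m ∧ d * m = m' * d := by
  induction m using pos_induction with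
  | h1 => exact ⟨1, by simp⟩
  | hmul s m ih =>
    rw [supp_mul, supp_pgen] at hm
    obtain ⟨m', h1, h2, h3⟩ := ih hm.2
    obtain ⟨y', hy', h4⟩ := h s hm.1
    refine ⟨pgen M y' * m', by simp [hy', h1], by simp [h2], ?_⟩
    rw [← mul_assoc, h4, mul_assoc, h3, mul_assoc]

omit [Finite B] in
theorem exists_transport_symm {Y Y' : Set B} {d : Pos M}
    (h : ∀ y' ∈ Y', ∃ y ∈ Y, d * pgen M y = pgen M y' * d) {m' : Pos M} (hm : Supp Y' m') :
    ∃ m, Supp Y m ∧ plen m' = plen m ∧ d * m = m' * d := by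
  induction m' using pos_induction with
  | h1 => exact ⟨1, by simp⟩
  | hmul s m' ih =>
    rw [supp_mul, supp_pgen] at hm
    obtain ⟨m, h1, h2, h3⟩ := ih hm.2
    obtain ⟨y, hy, h4⟩ := h s hm.1
    refine ⟨pgen M y * m, by simp [hy, h1], by simp [h2], ?_⟩
    rw [← mul_assoc, h4, mul_assoc, h3, mul_assoc]

theorem mul_dl_of_conj {Y Y' : Set B} {d : Pos M}
    (h : ∀ y ∈ Y, ∃ y' ∈ Y', d * pgen M y = pgen M y' * d)
    (h' : ∀ y' ∈ Y', ∃ y ∈ Y, d * pgen M y = pgen M y' * d) :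
    d * dl cs Y = dl cs Y' * d := by
  obtain ⟨m', -, h2, h3⟩ := exists_transport h (supp_dl cs Y)
  obtain ⟨m, -, h5, h6⟩ := exists_transport_symm h' (supp_dl cs Y')
  have h7 : dl cs Y' ∣ m' := by
    rw [dl_dvd_iff]
    intro y' hy'
    obtain ⟨y, hy, h8⟩ := h' y' hy'
    obtain ⟨c, hc⟩ := pgen_dvd_dl cs hy
    have hs : Supp Y c := by
      have := supp_dl cs Y
      rw [hc, supp_mul] at this
      exact this.2
    obtain ⟨c', -, -, h9⟩ := exists_transport h hs
    refine ⟨c', pos_mul_right_cancel cs (a := d) ?_⟩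
    rw [← h3, hc, ← mul_assoc, h8, mul_assoc, h9, mul_assoc]
  have h8 : dl cs Y ∣ m := by
    rw [dl_dvd_iff]
    intro y hy
    obtain ⟨y', hy', h8⟩ := h y hy
    obtain ⟨c', hc⟩ := pgen_dvd_dl cs hy'
    have hs : Supp Y' c' := by
      have := supp_dl cs Y'
      rw [hc, supp_mul] at this
      exact this.2
    obtain ⟨c, -, -, h9⟩ := exists_transport_symm h' hs
    refine ⟨c, pos_mul_left_cancel cs (a := d) ?_⟩
    rw [h6, hc, ← mul_assoc, h8, mul_assoc, ← h9, mul_assoc]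
  obtain ⟨e, he⟩ := h7
  obtain ⟨e', he'⟩ := h8
  have h9 : plen e = 0 := by
    rw [he, plen_mul] at h2
    rw [he', plen_mul] at h5
    omega
  rw [h3, he, eq_one_of_plen_eq_zero h9, mul_one]

/-- The elementary ribbon `Δ_{Y ∪ {t}} Δ_Y⁻¹`. -/
theorem exists_elementary_ribbon {Y : Set B} {t : B} (ht : t ∉ Y) :
    ∃ d, dl cs (insert t Y) = d * dl cs Y ∧ (∃ d', d = d' * pgen M t) ∧
      ∀ y ∈ Y, ∃ y', d * pgen M y = pgen M y' * d := by
  obtain ⟨d, hd⟩ := (dl_rdvd_iff cs (Z := Y) (m := dl cs (insert t Y))).mpr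
    (fun y hy => exists_dl_eq_mul_pgen cs (Set.mem_insert_of_mem _ hy))
  refine ⟨d, hd, ?_, fun y hy => ?_⟩
  · have hne : d ≠ 1 := by
      rintro rfl
      rw [one_mul] at hd
      obtain ⟨c, hc⟩ := pgen_dvd_dl cs (Set.mem_insert t Y)
      have := supp_dl cs Y
      rw [← hd, hc, supp_mul, supp_pgen] at this
      exact ht this.1
    obtain ⟨x, d', rfl⟩ := exists_eq_mul_pgen hne
    have hx : x ∈ insert t Y := by
      have := supp_dl cs (insert t Y)
      rw [hd, supp_mul, supp_mul, supp_pgen] at this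
      exact this.1.2
    rcases hx with rfl | hx
    · exact ⟨d', rfl⟩
    · obtain ⟨c, hc⟩ := pgen_dvd_dl cs hx
      rw [hc, ← mul_assoc] at hd
      exact absurd hd (dl_squarefree cs _ _ _)
  · obtain ⟨y1, hy1, h1⟩ := exists_pgen_mul_dl cs hy
    obtain ⟨σ, hσ⟩ := exists_perm cs (insert t Y)
    obtain ⟨y0, h0⟩ := σ.surjective ⟨y1, Set.mem_insert_of_mem _ hy1⟩
    have h2 := hσ y0
    rw [h0] at h2
    refine ⟨y0, pos_mul_right_cancel cs (a := dl cs Y) ?_⟩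
    rw [mul_assoc, h1, ← mul_assoc, ← hd, ← h2, hd, mul_assoc]

theorem eq_mul_of_mul_dl_pow_eq_mul_pgen {Y : Set B} {t : B} {d d' : Pos M}
    (hd : dl cs (insert t Y) = d * dl cs Y) (hd' : d = d' * pgen M t) {v w : Pos M} {n : ℕ}
    (h : v * dl cs Y ^ (n + 1) = w * pgen M t) : ∃ c, v = c * d := by
  induction n generalizing w with
  | zero =>
    obtain ⟨c, hc⟩ := (dl_rdvd_iff cs (Z := insert t Y) (m := v * dl cs Y ^ (0 + 1))).mpr (by
      rintro y (rfl | hy)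
      · exact ⟨w, h⟩
      · obtain ⟨c, hc⟩ := exists_dl_eq_mul_pgen cs hy
        exact ⟨v * c, by rw [zero_add, pow_one, hc, mul_assoc]⟩)
    rw [zero_add, pow_one, hd, ← mul_assoc] at hc
    exact ⟨c, pos_mul_right_cancel cs hc⟩
  | succ n ih =>
    obtain ⟨c, hc⟩ := (dl_rdvd_iff cs (Z := insert t Y) (m := v * dl cs Y ^ (n + 1 + 1))).mpr (by
      rintro y (rfl | hy)
      · exact ⟨w, h⟩
      · obtain ⟨c, hc⟩ := exists_dl_eq_mul_pgen cs hy
        exact ⟨v * dl cs Y ^ (n + 1) * c, by rw [pow_succ _ (n + 1), mul_assoc, mul_assoc,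
          ← hc]⟩)
    rw [hd, pow_succ, ← mul_assoc, ← mul_assoc] at hc
    have := pos_mul_right_cancel cs hc
    rw [hd', ← mul_assoc] at this
    exact ih this

/-- A positive element conjugating a power of `Δ_Y` into `A_X⁺` and having no right divisor in `Y`
conjugates `Y` into `X`. -/
theorem conj_of_mul_dl_pow {X Y : Set B} {u h : Pos M} {k : ℕ} (hk : 1 ≤ k)
    (hu : ∀ y ∈ Y, ¬ ∃ c, u = c * pgen M y) (hh : Supp X h) (he : u * dl cs Y ^ k = h * u) :
    ∀ y ∈ Y, ∃ x ∈ X, u * pgen M y = pgen M x * u := by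
  induction hn : plen u using Nat.strong_induction_on generalizing u Y with
  | _ n ih =>
    obtain ⟨j, rfl⟩ : ∃ j, k = j + 1 := ⟨k - 1, by omega⟩
    by_cases hu1 : u = 1
    · subst hu1
      intro y hy
      refine ⟨y, ?_, by simp⟩
      obtain ⟨c, hc⟩ := pgen_dvd_dl cs hy
      rw [one_mul, mul_one] at he
      rw [← he, pow_succ', hc, supp_mul, supp_mul, supp_pgen] at hh
      exact hh.1.1
    · obtain ⟨t, u', rfl⟩ := exists_eq_mul_pgen hu1
      have ht : t ∉ Y := fun ht => hu t ht ⟨u', rfl⟩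
      obtain ⟨d, hd, ⟨d', hd'⟩, hY⟩ := exists_elementary_ribbon cs ht
      rw [← mul_assoc h] at he
      obtain ⟨u1, hu1⟩ := eq_mul_of_mul_dl_pow_eq_mul_pgen cs hd hd' he
      rw [mul_assoc h] at he
      rw [hu1] at he hu hn ⊢
      let Y' : Set B := {y' | ∃ y ∈ Y, d * pgen M y = pgen M y' * d}
      have hY1 : ∀ y ∈ Y, ∃ y' ∈ Y', d * pgen M y = pgen M y' * d := by
        intro y hy
        obtain ⟨y', h'⟩ := hY y hy
        exact ⟨y', ⟨y, hy, h'⟩, h'⟩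
      have hT : SemiconjBy d (dl cs Y) (dl cs Y') := mul_dl_of_conj cs hY1 (fun y' h => h)
      have hTk := (hT.pow_right (j + 1)).eq
      have key := ih (plen u1) (by rw [← hn, hd']; simp) (Y := Y') (u := u1) (by
        rintro y' ⟨y, hy, h'⟩ ⟨c, hc⟩
        exact hu y hy ⟨c * d, by rw [mul_assoc, h', hc, mul_assoc]⟩) (by
        apply pos_mul_right_cancel cs (a := d)
        rw [mul_assoc, ← hTk, ← mul_assoc, he, mul_assoc]) rfl
      intro y hy
      obtain ⟨y', hy', h'⟩ := hY1 y hy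
      obtain ⟨x, hx, hx'⟩ := key y' hy'
      exact ⟨x, hx, by rw [mul_assoc, h', ← mul_assoc, hx', mul_assoc]⟩

theorem dl_dvd_of_dvd_mul {X : Set B} {h u : Pos M} (hh : Supp X h)
    (hu : ∀ x ∈ X, ¬ pgen M x ∣ u) (hd : dl cs X ∣ h * u) : dl cs X ∣ h := by
  rw [dl_dvd_iff] at hd ⊢
  intro s hs
  have h1 := hd s hs
  rw [← lft_simple cs, lft_dvd_mul_iff] at h1
  have h2 := (supp_act_cpl cs hh (w := cs.simple s) (by rw [lft_simple]; simpa using hs)).1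
  rw [← lft_simple cs, lft_dvd_iff]
  by_contra hne
  obtain ⟨x, c, hx⟩ := exists_eq_pgen_mul (m := lft cs (act cs h (cs.simple s))) (by
    intro h3
    apply hne
    rw [← pproj_lft cs (act cs h (cs.simple s)), h3, map_one])
  rw [hx] at h1 h2
  rw [supp_mul, supp_pgen] at h2
  exact hu x h2.1 (dvd_trans (dvd_mul_right _ _) h1)

theorem exists_eq_of_dl_pow_mul {X : Set B} {h u v : Pos M} (hh : Supp X h)
    (hu : ∀ x ∈ X, ¬ pgen M x ∣ u) {n : ℕ} (he : dl cs X ^ n * v = h * u) :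
    ∃ h', Supp X h' ∧ v = h' * u := by
  induction n generalizing h with
  | zero => exact ⟨h, hh, by simpa using he⟩
  | succ n ih =>
    obtain ⟨h1, rfl⟩ := dl_dvd_of_dvd_mul cs hh hu
      ⟨dl cs X ^ n * v, by rw [← he, pow_succ', mul_assoc]⟩
    rw [supp_mul] at hh
    rw [pow_succ', mul_assoc, mul_assoc] at he
    exact ih hh.2 (pos_mul_left_cancel cs he)

end Ribbon

section Group

variable {M : CoxeterMatrix B} {X : Set B}

theorem mem_posMonOn_iff {g : Artin M} : g ∈ posMonOn M X ↔ ∃ m, Supp X m ∧ toArtin M m = g := by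
  constructor
  · intro hg
    induction hg using Submonoid.closure_induction with
    | mem x hx =>
      obtain ⟨s, hs, rfl⟩ := hx
      exact ⟨pgen M s, by simpa using hs, rfl⟩
    | one => exact ⟨1, by simp⟩
    | mul a b _ _ ha hb =>
      obtain ⟨m, hm, rfl⟩ := ha
      obtain ⟨n, hn, rfl⟩ := hb
      exact ⟨m * n, by simp [hm, hn]⟩
  · rintro ⟨m, hm, rfl⟩
    induction m using pos_induction with
    | h1 => rw [map_one]; exact one_mem _
    | hmul s m ih =>
      rw [supp_mul, supp_pgen] at hm
      rw [map_mul]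
      exact mul_mem (Submonoid.subset_closure ⟨s, hm.1, rfl⟩) (ih hm.2)

theorem toArtin_mem_stdSub {m : Pos M} (hm : Supp X m) : toArtin M m ∈ stdSub M X := by
  induction m using pos_induction with
  | h1 => rw [map_one]; exact one_mem _
  | hmul s m ih =>
    rw [supp_mul, supp_pgen] at hm
    rw [map_mul]
    exact mul_mem (Subgroup.subset_closure ⟨s, hm.1, rfl⟩) (ih hm.2)

theorem mem_QZset_iff {q : Artin M} : q ∈ QZset M X ↔
    (∀ x ∈ X, ∃ y ∈ X, q * gen M x = gen M y * q) ∧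
      ∀ y ∈ X, ∃ x ∈ X, q * gen M x = gen M y * q := by
  constructor
  · intro (h : rightMul M X q = leftMul M X q)
    constructor
    · intro x hx
      obtain ⟨y, hy, h'⟩ := h.le ⟨x, hx, rfl⟩
      exact ⟨y, hy, h'.symm⟩
    · intro y hy
      obtain ⟨x, hx, h'⟩ := h.ge ⟨y, hy, rfl⟩
      exact ⟨x, hx, h'⟩
  · rintro ⟨h1, h2⟩
    refine Set.Subset.antisymm ?_ ?_
    · rintro _ ⟨x, hx, rfl⟩
      obtain ⟨y, hy, h⟩ := h1 x hx
      exact ⟨y, hy, h.symm⟩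
    · rintro _ ⟨y, hy, rfl⟩
      obtain ⟨x, hx, h⟩ := h2 y hy
      exact ⟨x, hx, h⟩

theorem conj_mem_stdSub {c : Artin M} (h : ∀ x ∈ X, c * gen M x * c⁻¹ ∈ stdSub M X)
    {a : Artin M} (ha : a ∈ stdSub M X) : c * a * c⁻¹ ∈ stdSub M X := by
  have : stdSub M X ≤ (stdSub M X).comap (MulAut.conj c).toMonoidHom := by
    rw [stdSub, Subgroup.closure_le]
    rintro _ ⟨x, hx, rfl⟩
    exact h x hx
  exact this ha

theorem prod_QZset_comm :
    {x : Artin M | ∃ a ∈ stdSub M X, ∃ q ∈ QZset M X, x = a * q}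
        = {x : Artin M | ∃ q ∈ QZset M X, ∃ a ∈ stdSub M X, x = q * a} := by
  ext x
  constructor
  · rintro ⟨a, ha, q, hq, rfl⟩
    refine ⟨q, hq, q⁻¹ * a * q⁻¹⁻¹, conj_mem_stdSub (fun y hy => ?_) ha, by group⟩
    obtain ⟨x, hx, h⟩ := (mem_QZset_iff.mp hq).2 y hy
    rw [inv_inv, mul_assoc, ← h, inv_mul_cancel_left]
    exact Subgroup.subset_closure ⟨x, hx, rfl⟩
  · rintro ⟨q, hq, a, ha, rfl⟩
    refine ⟨q * a * q⁻¹, conj_mem_stdSub (fun x hx => ?_) ha, q, hq, by group⟩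
    obtain ⟨y, hy, h⟩ := (mem_QZset_iff.mp hq).1 x hx
    rw [h, mul_inv_cancel_right]
    exact Subgroup.subset_closure ⟨y, hy, rfl⟩

theorem mem_stdSub_univ (g : Artin M) : g ∈ stdSub M Set.univ := by
  rw [stdSub, Set.image_univ]
  have : Subgroup.closure (Set.range (gen M)) = ⊤ :=
    PresentedGroup.closure_range_of (braidRels M)
  rw [this]
  trivial

variable {W : Type*} [Group W] (cs : CoxeterSystem M W) [Finite W] [Finite B]

include cs in
theorem eq_toArtin_dl {d : Artin M} (hd : IsDelta M X d) : d = toArtin M (dl cs X) := by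
  have hinj := toArtin_injective cs
  obtain ⟨h1, h2, h3⟩ := hd
  obtain ⟨m, hm, rfl⟩ := mem_posMonOn_iff.mp h1
  have h4 : dl cs X ∣ m := by
    rw [dl_dvd_iff]
    intro s hs
    obtain ⟨c, hc, h⟩ := h2 s hs
    obtain ⟨c, -, rfl⟩ := mem_posMonOn_iff.mp hc
    rw [← toArtin_pgen, ← map_mul] at h
    exact ⟨c, (hinj h).symm⟩
  obtain ⟨c, hc, h5⟩ := h3 (toArtin M (dl cs X)) (mem_posMonOn_iff.mpr ⟨_, supp_dl cs X, rfl⟩) (by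
    intro s hs
    obtain ⟨c, hc⟩ := pgen_dvd_dl cs hs
    have h := supp_dl cs X
    rw [hc, supp_mul] at h
    exact ⟨toArtin M c, mem_posMonOn_iff.mpr ⟨c, h.2, rfl⟩, by
      rw [hc, map_mul, toArtin_pgen]⟩)
  obtain ⟨c, -, rfl⟩ := mem_posMonOn_iff.mp hc
  rw [← map_mul] at h5
  have h5 := hinj h5
  obtain ⟨e, he⟩ := h4
  have h6 : plen c = 0 := by
    have h7 := congrArg plen h5
    have h8 := congrArg plen he
    rw [plen_mul] at h7 h8
    omega
  rw [← h5, eq_one_of_plen_eq_zero h6, mul_one]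

omit [Finite B] in
omit [Finite B] in
/-- Elements of a standard parabolic subgroup are fractions with a power of `z` as
denominator. -/
theorem exists_pow_mul_eq_toArtin {z : Pos M} (hzX : Supp X z)
    (hz : ∀ m, Supp X m → m * z = z * m)
    (hdiv : ∀ m, Supp X m → ∃ (n : ℕ) (c : Pos M), Supp X c ∧ c * m = z ^ n ∧ m * c = z ^ n)
    {g : Artin M} (hg : g ∈ stdSub M X) :
    ∃ (n : ℕ) (p : Pos M), Supp X p ∧ toArtin M z ^ n * g = toArtin M p := by
  have hzn : ∀ (n : ℕ) (m : Pos M), Supp X m →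
      toArtin M m * toArtin M z ^ n = toArtin M z ^ n * toArtin M m := by
    intro n m hm
    have h : Commute (toArtin M m) (toArtin M z) := by
      rw [commute_iff_eq, ← map_mul, ← map_mul, hz m hm]
    exact (h.pow_right n).eq
  induction hg using Subgroup.closure_induction with
  | mem x hx =>
    obtain ⟨s, hs, rfl⟩ := hx
    exact ⟨0, pgen M s, by simpa using hs, by simp⟩
  | one => exact ⟨0, 1, by simp⟩
  | mul a b _ _ ha hb =>
    obtain ⟨n, p, hp, h⟩ := ha
    obtain ⟨n', p', hp', h'⟩ := hb
    refine ⟨n' + n, p * p', by simp [hp, hp'], ?_⟩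
    rw [pow_add, mul_assoc, ← mul_assoc _ a, h, ← mul_assoc, ← hzn _ _ hp, mul_assoc, h', map_mul]
  | inv a _ ha =>
    obtain ⟨n, p, hp, h⟩ := ha
    obtain ⟨k, c, hc, h', -⟩ := hdiv p hp
    refine ⟨k, c * z ^ n, (supp_mul X _ _).mpr ⟨hc, supp_pow hzX n⟩, ?_⟩
    rw [← map_pow, ← h', map_mul, ← h, map_mul, map_pow]
    group

omit [Finite B] in
omit [Finite B] in
/-- Every positive element is `a g b` with `a, b ∈ A_X⁺` and `g` reduced on both sides. -/
theorem exists_reduced_decomposition (X : Set B) (m : Pos M) : ∃ a g b : Pos M,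
    Supp X a ∧ Supp X b ∧ m = a * g * b ∧ (∀ x ∈ X, ¬ pgen M x ∣ g) ∧
      ∀ x ∈ X, ¬ ∃ c, g = c * pgen M x := by
  induction hn : plen m using Nat.strong_induction_on generalizing m with
  | _ n ih =>
    by_cases h1 : ∃ x ∈ X, pgen M x ∣ m
    · obtain ⟨x, hx, c, rfl⟩ := h1
      obtain ⟨a, g, b, ha, hb, rfl, hg⟩ := ih (plen c) (by rw [← hn]; simp) c rfl
      exact ⟨pgen M x * a, g, b, by simp [hx, ha], hb, by simp only [mul_assoc], hg⟩
    by_cases h2 : ∃ x ∈ X, ∃ c, m = c * pgen M x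
    · obtain ⟨x, hx, c, rfl⟩ := h2
      obtain ⟨a, g, b, ha, hb, rfl, hg⟩ := ih (plen c) (by rw [← hn]; simp) c rfl
      exact ⟨a, g, b * pgen M x, ha, by simp [hx, hb], by simp only [mul_assoc], hg⟩
    push Not at h1 h2
    exact ⟨1, m, 1, by simp, by simp, by simp, h1, fun x hx ⟨c, hc⟩ => h2 x hx c hc⟩

include cs in
theorem mem_QZset_of_conj_pow {u : Pos M} (hl : ∀ x ∈ X, ¬ pgen M x ∣ u)
    (hr : ∀ x ∈ X, ¬ ∃ c, u = c * pgen M x) {k : ℕ} (hk : 1 ≤ k)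
    (h : toArtin M u * toArtin M (dl cs X) ^ k * (toArtin M u)⁻¹ ∈ stdSub M X) :
    (∀ y ∈ X, ∃ x ∈ X, u * pgen M y = pgen M x * u) ∧ toArtin M u ∈ QZset M X := by
  obtain ⟨κ, -, hz, hdiv⟩ := exists_central cs X
  obtain ⟨n, p, hp, he⟩ := exists_pow_mul_eq_toArtin (supp_pow (supp_dl cs X) κ) hz hdiv h
  have h1 : dl cs X ^ (κ * n) * (u * dl cs X ^ k) = p * u := by
    apply toArtin_injective cs
    rw [map_mul, map_mul _ p, ← he, pow_mul]
    simp only [map_mul, map_pow]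
    group
  obtain ⟨h', hh', h2⟩ := exists_eq_of_dl_pow_mul cs hp hl h1
  have h3 := conj_of_mul_dl_pow cs hk hr hh' h2
  refine ⟨h3, mem_QZset_iff.mpr ?_⟩
  choose f hf hf' using fun y : X => h3 y y.2
  have hinj : Function.Injective (fun y : X => (⟨f y, hf y⟩ : X)) := by
    intro y y' h
    have h4 : f y = f y' := congrArg Subtype.val h
    have h5 := hf' y
    rw [h4, ← hf' y'] at h5
    exact Subtype.ext (pgen_injective M (pos_mul_left_cancel cs h5))
  have hf'' : ∀ y : X, toArtin M u * gen M y = gen M (f y) * toArtin M u := by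
    intro y
    rw [← toArtin_pgen, ← toArtin_pgen, ← map_mul, ← map_mul, hf']
  constructor
  · exact fun x hx => ⟨f ⟨x, hx⟩, hf _, hf'' ⟨x, hx⟩⟩
  · intro y hy
    obtain ⟨x, hx⟩ := Finite.surjective_of_injective hinj ⟨y, hy⟩
    refine ⟨x, x.2, ?_⟩
    rw [hf'', show f x = y from congrArg Subtype.val hx]

include cs in
theorem exists_mul_QZset_of_conj_pow {g : Artin M} {k : ℕ} (hk : 1 ≤ k)
    (h : g * toArtin M (dl cs X) ^ k * g⁻¹ ∈ stdSub M X) :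
    ∃ a ∈ stdSub M X, ∃ q ∈ QZset M X, g = a * q := by
  obtain ⟨κ, hκ, hz, hdiv⟩ := exists_central cs (Set.univ : Set B)
  set z := toArtin M (dl cs Set.univ ^ κ)
  have hcen : ∀ x : Artin M, Commute z x := by
    intro x
    obtain ⟨n, p, -, hp⟩ := exists_pow_mul_eq_toArtin (supp_univ M _) hz hdiv (mem_stdSub_univ x)
    have h1 : Commute z (z ^ n * x) := by
      rw [hp, commute_iff_eq, ← map_mul, ← map_mul, hz p (supp_univ M p)]
    rw [← inv_mul_cancel_left (z ^ n) x]
    exact ((Commute.refl z).pow_right n).inv_right.mul_right h1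
  obtain ⟨n, g0, -, hg0⟩ := exists_pow_mul_eq_toArtin (supp_univ M _) hz hdiv (mem_stdSub_univ g)
  have hg : g = (z ^ n)⁻¹ * toArtin M g0 := by rw [← hg0, inv_mul_cancel_left]
  have hcn : ∀ x : Artin M, Commute (z ^ n)⁻¹ x := fun x => ((hcen x).pow_left n).inv_left
  obtain ⟨a, u, b, ha, hb, rfl, hl, hr⟩ := exists_reduced_decomposition X g0
  obtain ⟨κ', hκ', hzX, -⟩ := exists_central cs X
  have h1 : toArtin M u * toArtin M (dl cs X) ^ (κ' * k) * (toArtin M u)⁻¹ ∈ stdSub M X := by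
    have h2 := pow_mem h κ'
    rw [conj_pow, ← pow_mul, mul_comm k] at h2
    have h3 : Commute (toArtin M b) (toArtin M (dl cs X) ^ (κ' * k)) := by
      rw [pow_mul]
      apply Commute.pow_right
      rw [commute_iff_eq, ← map_pow, ← map_mul, ← map_mul, hzX b hb]
    have h4 : toArtin M u * toArtin M (dl cs X) ^ (κ' * k) * (toArtin M u)⁻¹ =
        (toArtin M a)⁻¹ * (g * toArtin M (dl cs X) ^ (κ' * k) * g⁻¹) * toArtin M a := by
      have h5 : g = toArtin M a * toArtin M u * toArtin M b * (z ^ n)⁻¹ := by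
        rw [hg, (hcn _).eq, map_mul, map_mul]
      have h6 : ∀ p v c w d : Artin M, Commute c d → Commute w d →
          p⁻¹ * (p * v * c * w * d * (p * v * c * w)⁻¹) * p = v * d * v⁻¹ := by
        intro p v c w d hc hw
        have h7 : p⁻¹ * (p * v * c * w * d * (p * v * c * w)⁻¹) * p =
            v * (c * (w * d) * w⁻¹ * c⁻¹) * v⁻¹ := by group
        rw [h7, hw.eq, mul_assoc c, mul_assoc d, mul_inv_cancel, mul_one, hc.eq,
          mul_assoc d, mul_inv_cancel, mul_one]
      rw [h5, h6 _ _ _ _ _ h3 (hcn _)]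
    rw [h4]
    exact mul_mem (mul_mem (inv_mem (toArtin_mem_stdSub ha)) h2) (toArtin_mem_stdSub ha)
  obtain ⟨h2, h3⟩ := mem_QZset_of_conj_pow cs hl hr (Nat.mul_pos hκ' hk) h1
  obtain ⟨b', hb', -, h4⟩ := exists_transport h2 hb
  refine ⟨toArtin M (a * b'), toArtin_mem_stdSub ((supp_mul X _ _).mpr ⟨ha, hb'⟩),
    (z ^ n)⁻¹ * toArtin M u, ?_, ?_⟩
  · have h5 : ∀ x y : B, toArtin M u * gen M x = gen M y * toArtin M u →
        (z ^ n)⁻¹ * toArtin M u * gen M x = gen M y * ((z ^ n)⁻¹ * toArtin M u) := by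
      intro x y hxy
      rw [mul_assoc, hxy, ← mul_assoc, (hcn _).eq, mul_assoc]
    rw [mem_QZset_iff] at h3 ⊢
    constructor
    · intro x hx
      obtain ⟨y, hy, hxy⟩ := h3.1 x hx
      exact ⟨y, hy, h5 x y hxy⟩
    · intro y hy
      obtain ⟨x, hx, hxy⟩ := h3.2 y hy
      exact ⟨x, hx, h5 x y hxy⟩
  · rw [hg, mul_assoc a, h4, ← mul_assoc a, map_mul, ← mul_assoc, (hcn _).eq, mul_assoc]

end Group

/-- **Inclusion from the proof of Theorem 1 (Godelle).** In a spherical-type Artin-Tits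
system, `{g : ∃ k ≥ 1, gΔ_X^kg⁻¹ ∈ A_X} ⊆ A_X · QZ_{A_S}(A_X)`, and
`A_X · QZ_{A_S}(A_X) = QZ_{A_S}(A_X) · A_X`. -/
theorem conj_delta_mem_prod
    [Finite B] (M : CoxeterMatrix B) (hsph : Finite M.Group) (X : Set B)
    (Δ : Artin M) (hΔ : IsDelta M X Δ) :
    ({g : Artin M | ∃ k : ℕ, 1 ≤ k ∧ g * Δ ^ k * g⁻¹ ∈ stdSub M X}
        ⊆ {x : Artin M | ∃ a ∈ stdSub M X, ∃ q ∈ QZset M X, x = a * q}) ∧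
    ({x : Artin M | ∃ a ∈ stdSub M X, ∃ q ∈ QZset M X, x = a * q}
        = {x : Artin M | ∃ q ∈ QZset M X, ∃ a ∈ stdSub M X, x = q * a}) := by
  refine ⟨?_, prod_QZset_comm⟩
  rintro g ⟨k, hk, h⟩
  rw [eq_toArtin_dl M.toCoxeterSystem hΔ] at h
  exact exists_mul_QZset_of_conj_pow M.toCoxeterSystem hk h

end ArtinTitsPaper
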